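/- arXiv:1504.08176 — 2 statements merged into one kernel-verified Lean document; each statement's English description precedes it below -/
import Mathlib

section
/- Let μ : M → X be a homomorphism of finitely generated R-modules with X maximal Cohen–Macaulay. Then μ is a special CM-preenvelope of M if and only if cod(ker μ) > 0 and Ext^1_R(coker μ, Z) = 0 for every maximal Cohen–Macaulay R-module Z. -/
open CategoryTheory

noncomputable section

/-- `Ext^n_A(M, N)` as a module. -/
def ext1 (A : Type) [CommRing A] (n : ℕ) (M N : Type) [AddCommGroup M] [Module A M]
    [AddCommGroup N] [Module A N] : ModuleCat A :=
  ((Ext A (ModuleCat A) n).obj (Opposite.op (ModuleCat.of A M))).obj (ModuleCat.of A N)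

/-- The depth of a module over a local ring: the least `n` with `Ext^n(k, M) ≠ 0`
(`⊤` if no such `n`, e.g. for the zero module). -/
def rdepth (A : Type) [CommRing A] [IsLocalRing A] (M : Type) [AddCommGroup M] [Module A M] :
    ℕ∞ :=
  sInf {n : ℕ∞ | ∃ m : ℕ, n = m ∧ ¬ Subsingleton (ext1 A m (IsLocalRing.ResidueField A) M)}

/-- The dimension of a module, `dim M = dim (A / ann M)`. -/
def mdim (A : Type) [CommRing A] (M : Type) [AddCommGroup M] [Module A M] : WithBot ℕ∞ :=
  ringKrullDim (A ⧸ Module.annihilator A M)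

/-- `cod M > n`, i.e. `dim A - dim M > n`, i.e. `dim M + n < d`. -/
def codGT (A : Type) [CommRing A] (d : ℕ) (M : Type) [AddCommGroup M] [Module A M]
    (n : ℕ) : Prop :=
  mdim A M + n < (d : WithBot ℕ∞)

/-- `cod M ≥ n`, i.e. `dim M + n ≤ d`. -/
def codGE (A : Type) [CommRing A] (d : ℕ) (M : Type) [AddCommGroup M] [Module A M]
    (n : ℕ) : Prop :=
  mdim A M + n ≤ (d : WithBot ℕ∞)

/-- Maximal Cohen-Macaulay module over a `d`-dimensional local ring
(the zero module counts as MCM). -/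
def IsMCM (A : Type) [CommRing A] [IsLocalRing A] (d : ℕ) (M : Type) [AddCommGroup M]
    [Module A M] : Prop :=
  Module.Finite A M ∧ (d : ℕ∞) ≤ rdepth A M

/-- Serre's condition `(S_n)`: `depth M_p ≥ min {n, ht p}` for all primes `p`. -/
def SerreS (A : Type) [CommRing A] (n : ℕ) (M : Type) [AddCommGroup M] [Module A M] : Prop :=
  ∀ p : PrimeSpectrum A,
    min (n : WithBot ℕ∞) (ringKrullDim (Localization.AtPrime p.asIdeal))
      ≤ (rdepth (Localization.AtPrime p.asIdeal)
          (LocalizedModule p.asIdeal.primeCompl M) : ℕ∞)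

/-- Finite injective dimension: `Ext^m(-, M)` vanishes for all large `m`. -/
def HasFID (A : Type) [CommRing A] (M : Type) [AddCommGroup M] [Module A M] : Prop :=
  ∃ n : ℕ, ∀ (N : Type) [AddCommGroup N] [Module A N], ∀ m : ℕ, n < m →
    Subsingleton (ext1 A m N M)

/-- `ω` is a canonical module of the `d`-dimensional local ring `A`:
it is maximal Cohen-Macaulay, of finite injective dimension, and of type one. -/
def IsCanonicalModule (A : Type) [CommRing A] [IsLocalRing A] (d : ℕ) (ω : Type)
    [AddCommGroup ω] [Module A ω] : Prop :=
  IsMCM A d ω ∧ HasFID A ω ∧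
    Nonempty ((ext1 A d (IsLocalRing.ResidueField A) ω) ≃ₗ[A] IsLocalRing.ResidueField A)

/-- `μ : M → X` is a CM-preenvelope. -/
def IsCMPreenvelope (A : Type) [CommRing A] [IsLocalRing A] (d : ℕ) {M X : Type}
    [AddCommGroup M] [Module A M] [AddCommGroup X] [Module A X] (μ : M →ₗ[A] X) : Prop :=
  IsMCM A d X ∧ ∀ (Z : Type) [AddCommGroup Z] [Module A Z], IsMCM A d Z →
    ∀ f : M →ₗ[A] Z, ∃ g : X →ₗ[A] Z, g ∘ₗ μ = f

/-- `μ : M → X` is a special CM-preenvelope: a CM-preenvelope with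
`Ext^1(coker μ, Z) = 0` for all maximal Cohen-Macaulay `Z`. -/
def IsSpecialCMPreenvelope (A : Type) [CommRing A] [IsLocalRing A] (d : ℕ) {M X : Type}
    [AddCommGroup M] [Module A M] [AddCommGroup X] [Module A X] (μ : M →ₗ[A] X) : Prop :=
  IsCMPreenvelope A d μ ∧ ∀ (Z : Type) [AddCommGroup Z] [Module A Z], IsMCM A d Z →
    Subsingleton (ext1 A 1 (X ⧸ LinearMap.range μ) Z)

/-- `μ : M → X` is a CM-envelope. -/
def IsCMEnvelope (A : Type) [CommRing A] [IsLocalRing A] (d : ℕ) {M X : Type}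
    [AddCommGroup M] [Module A M] [AddCommGroup X] [Module A X] (μ : M →ₗ[A] X) : Prop :=
  IsCMPreenvelope A d μ ∧ ∀ φ : X →ₗ[A] X, φ ∘ₗ μ = μ → Function.Bijective φ

/-- `π : X → M` is a CM-precover. -/
def IsCMPrecover (A : Type) [CommRing A] [IsLocalRing A] (d : ℕ) {X M : Type}
    [AddCommGroup X] [Module A X] [AddCommGroup M] [Module A M] (π : X →ₗ[A] M) : Prop :=
  IsMCM A d X ∧ ∀ (Z : Type) [AddCommGroup Z] [Module A Z], IsMCM A d Z →
    ∀ f : Z →ₗ[A] M, ∃ g : Z →ₗ[A] X, π ∘ₗ g = f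

/-- `π : X → M` is a special CM-precover: a CM-precover with
`Ext^1(Z, ker π) = 0` for all maximal Cohen-Macaulay `Z`. -/
def IsSpecialCMPrecover (A : Type) [CommRing A] [IsLocalRing A] (d : ℕ) {X M : Type}
    [AddCommGroup X] [Module A X] [AddCommGroup M] [Module A M] (π : X →ₗ[A] M) : Prop :=
  IsCMPrecover A d π ∧ ∀ (Z : Type) [AddCommGroup Z] [Module A Z], IsMCM A d Z →
    Subsingleton (ext1 A 1 Z ↥(LinearMap.ker π))

/-- `π : X → M` is a CM-cover. -/
def IsCMCover (A : Type) [CommRing A] [IsLocalRing A] (d : ℕ) {X M : Type}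
    [AddCommGroup X] [Module A X] [AddCommGroup M] [Module A M] (π : X →ₗ[A] M) : Prop :=
  IsCMPrecover A d π ∧ ∀ φ : X →ₗ[A] X, π ∘ₗ φ = π → Function.Bijective φ

/-- `M` has no nonzero free direct summand. -/
def NoNonzeroFreeSummand (A : Type) [CommRing A] (M : Type) [AddCommGroup M]
    [Module A M] : Prop :=
  ∀ F G : Submodule A M, IsCompl F G → Module.Free A ↥F → F = ⊥

/-- `W` belongs to `add ω`: it is a direct summand of a finite direct sum of copies of `ω`. -/
def InAdd (A : Type) [CommRing A] (ω : Type) [AddCommGroup ω] [Module A ω] (W : Type)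
    [AddCommGroup W] [Module A W] : Prop :=
  ∃ (n : ℕ) (W' : ModuleCat.{0} A), Nonempty ((W × ↥W') ≃ₗ[A] (Fin n → ω))

section delta

variable (A : Type) [CommRing A] (ω : Type) [AddCommGroup ω] [Module A ω]

/-- The natural evaluation map `δ_M : M → M†† = Hom(Hom(M, ω), ω)`. -/
def deltaMap (M : Type) [AddCommGroup M] [Module A M] :
    M →ₗ[A] ((M →ₗ[A] ω) →ₗ[A] ω) :=
  (LinearMap.id : (M →ₗ[A] ω) →ₗ[A] (M →ₗ[A] ω)).flip

/-- The dual `f† = Hom(f, ω)` of a linear map `f`. -/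
def dmap {M N : Type} [AddCommGroup M] [Module A M] [AddCommGroup N] [Module A N]
    (f : M →ₗ[A] N) : (N →ₗ[A] ω) →ₗ[A] (M →ₗ[A] ω) :=
  LinearMap.lcomp A ω f

end delta

/-- The homology `ker g / im f` at the middle spot of `M → N → P`. -/
abbrev homMod (A : Type) [CommRing A] {M N P : Type} [AddCommGroup M] [Module A M]
    [AddCommGroup N] [Module A N] [AddCommGroup P] [Module A P]
    (f : M →ₗ[A] N) (g : N →ₗ[A] P) : Type :=
  ↥(LinearMap.ker g) ⧸ Submodule.comap (LinearMap.ker g).subtype (LinearMap.range f)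

end

section ExtComparison

variable {R : Type} [CommRing R] (M N : ModuleCat.{0} R) (n : ℕ)

lemma subsingleton_ext_iff_isZero_homology (P : ProjectiveResolution M) :
    Subsingleton (((Ext R (ModuleCat R) n).obj (Opposite.op M)).obj N) ↔
      (P.complex.linearYonedaObj R N).ExactAt n := by
  rw [HomologicalComplex.exactAt_iff_isZero_homology]
  exact ⟨fun _ ↦ (ModuleCat.isZero_of_subsingleton _).of_iso (P.isoExt n N).symm,
    fun hz ↦ ModuleCat.subsingleton_of_isZero (hz.of_iso (P.isoExt n N))⟩

lemma subsingleton_abelianExt_iff_subsingleton_ext :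
    Subsingleton (Abelian.Ext M N n) ↔
      Subsingleton (((Ext R (ModuleCat R) n).obj (Opposite.op M)).obj N) := by
  let P := projectiveResolution M
  rw [subsingleton_ext_iff_isZero_homology M N n P]
  cases n with
  | zero =>
    rw [HomologicalComplex.exactAt_iff' _ 0 0 1 (by simp) (by simp),
      ShortComplex.moduleCat_exact_iff, Abelian.Ext.homEquiv₀.subsingleton_congr]
    obtain ⟨π, hπ, _, hdesc⟩ : ∃ π : P.complex.X 0 ⟶ M, P.complex.d 1 0 ≫ π = 0 ∧ Epi π ∧
        ∀ f : P.complex.X 0 ⟶ N, P.complex.d 1 0 ≫ f = 0 → ∃ g : M ⟶ N, π ≫ g = f :=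
      ⟨P.π.f 0, P.complex_d_comp_π_f_zero, (inferInstance : Epi (P.π.f 0)),
        fun f hf ↦ ⟨P.exact₀.desc f hf, P.exact₀.g_desc f hf⟩⟩
    constructor
    · intro h (f : P.complex.X 0 ⟶ N) (hf : P.complex.d 1 0 ≫ f = 0)
      refine ⟨0, ?_⟩
      obtain ⟨g, rfl⟩ := hdesc f hf
      rw [map_zero, Subsingleton.elim g 0, Limits.comp_zero]
      rfl
    · intro h
      refine subsingleton_of_forall_eq 0 fun g ↦ ?_
      have hg : P.complex.d 1 0 ≫ π ≫ g = 0 := by rw [reassoc_of% hπ, Limits.zero_comp]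
      obtain ⟨x, hx⟩ : ∃ x : P.complex.X 0 ⟶ N, P.complex.d 0 0 ≫ x = π ≫ g := h (π ≫ g) hg
      rw [P.complex.shape _ _ (by simp), Limits.zero_comp] at hx
      rw [← cancel_epi π, ← hx, Limits.comp_zero]
  | succ n =>
    rw [HomologicalComplex.exactAt_iff' _ n (n + 1) (n + 2) (by simp) (by simp),
      ShortComplex.moduleCat_exact_iff]
    constructor
    · intro h f hf
      exact (P.extMk_eq_zero_iff f _ rfl hf n rfl).1 (Subsingleton.elim _ _)
    · intro h
      refine subsingleton_of_forall_eq 0 fun x ↦ ?_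
      obtain ⟨f, hf, rfl⟩ := P.extMk_surjective x (n + 2) rfl
      exact (P.extMk_eq_zero_iff f _ _ hf n rfl).2 (h f hf)

end ExtComparison

section Ext

variable {R : Type} [CommRing R] {S : ShortComplex (ModuleCat.{0} R)}

lemma subsingleton_ext_X₂ (hS : S.ShortExact) (Y : ModuleCat.{0} R) (i : ℕ)
    (h₁ : Subsingleton (Abelian.Ext S.X₁ Y i))
    (h₃ : Subsingleton (Abelian.Ext S.X₃ Y i)) : Subsingleton (Abelian.Ext S.X₂ Y i) := by
  refine subsingleton_of_forall_eq 0 fun x ↦ ?_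
  obtain ⟨y, rfl⟩ := Abelian.Ext.contravariant_sequence_exact₂ hS Y x (Subsingleton.elim _ _)
  rw [Subsingleton.elim y 0, Abelian.Ext.comp_zero]

lemma exists_mk₀_f_comp_eq (hS : S.ShortExact) (Y : ModuleCat.{0} R) (i : ℕ)
    (h₃ : Subsingleton (Abelian.Ext S.X₃ Y (i + 1)))
    (x : Abelian.Ext S.X₁ Y i) :
    ∃ y : Abelian.Ext S.X₂ Y i, (Abelian.Ext.mk₀ S.f).comp y (zero_add i) = x :=
  Abelian.Ext.contravariant_sequence_exact₁ hS Y x (add_comm 1 i) (Subsingleton.elim _ _)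

lemma subsingleton_ext_X₁ (hS : S.ShortExact) (Y : ModuleCat.{0} R) (i : ℕ)
    (h₂ : Subsingleton (Abelian.Ext S.X₂ Y i))
    (h₃ : Subsingleton (Abelian.Ext S.X₃ Y (i + 1))) : Subsingleton (Abelian.Ext S.X₁ Y i) := by
  refine subsingleton_of_forall_eq 0 fun x ↦ ?_
  obtain ⟨y, rfl⟩ := exists_mk₀_f_comp_eq hS Y i h₃ x
  rw [Subsingleton.elim y 0, Abelian.Ext.comp_zero]

lemma eq_zero_of_mk₀_g_comp_eq_zero (hS : S.ShortExact) (Y : ModuleCat.{0} R) (i : ℕ)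
    (h₁ : ∀ j < i, Subsingleton (Abelian.Ext S.X₁ Y j))
    (x : Abelian.Ext S.X₃ Y i) (hx : (Abelian.Ext.mk₀ S.g).comp x (zero_add i) = 0) : x = 0 := by
  cases i with
  | zero =>
    have := hS.epi_g
    exact Abelian.Ext.precomp_mk₀_injective_of_epi Y S.g (by simpa using hx)
  | succ i =>
    have := h₁ i i.lt_succ_self
    obtain ⟨y, rfl⟩ := Abelian.Ext.contravariant_sequence_exact₃ hS Y x hx (add_comm 1 i)
    rw [Subsingleton.elim y 0, Abelian.Ext.comp_zero]

lemma mk₀_smul_id_comp {N : ModuleCat.{0} R} (Y : ModuleCat.{0} R) (i : ℕ) (r : R)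
    (x : Abelian.Ext N Y i) : (Abelian.Ext.mk₀ (r • 𝟙 N)).comp x (zero_add i) = r • x := by
  simp [Abelian.Ext.mk₀_smul]

lemma smul_ext_eq_zero_of_mem_annihilator_left {N : ModuleCat.{0} R} (Y : ModuleCat.{0} R) (i : ℕ)
    {r : R} (hr : r ∈ Module.annihilator R N) (x : Abelian.Ext N Y i) : r • x = 0 := by
  have : r • 𝟙 N = 0 := by
    ext y
    exact Module.mem_annihilator.1 hr y
  rw [← mk₀_smul_id_comp, this, Abelian.Ext.mk₀_zero, Abelian.Ext.zero_comp]

lemma smul_ext_eq_zero_of_mem_annihilator_right {N Y : ModuleCat.{0} R} (i : ℕ) {r : R}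
    (hr : r ∈ Module.annihilator R Y) (x : Abelian.Ext N Y i) : r • x = 0 := by
  have : r • 𝟙 Y = 0 := by
    ext y
    exact Module.mem_annihilator.1 hr y
  rw [Abelian.Ext.smul_eq_comp_mk₀, this, Abelian.Ext.mk₀_zero, Abelian.Ext.comp_zero]

end Ext

section FiniteModule

open IsLocalRing Pointwise

variable {R : Type} [CommRing R]

lemma shortExact_of_function_exact {N₁ N₂ N₃ : Type} [AddCommGroup N₁] [Module R N₁]
    [AddCommGroup N₂] [Module R N₂] [AddCommGroup N₃] [Module R N₃] {f : N₁ →ₗ[R] N₂}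
    {g : N₂ →ₗ[R] N₃} (hf : Function.Injective f) (hg : Function.Surjective g)
    (hfg : Function.Exact f g) :
    (ModuleCat.shortComplexOfCompEqZero f g hfg.linearMap_comp_eq_zero).ShortExact where
  exact := ModuleCat.shortComplex_exact _ hfg
  mono_f := (ModuleCat.mono_iff_injective _).2 hf
  epi_g := (ModuleCat.epi_iff_surjective _).2 hg

lemma subsingleton_ext_of_subsingleton (N Y : ModuleCat.{0} R) [Subsingleton N] (i : ℕ) :
    Subsingleton (Abelian.Ext N Y i) :=
  subsingleton_of_forall_eq 0 fun x ↦ by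
    rw [← Abelian.Ext.mk₀_id_comp x, (ModuleCat.isZero_of_subsingleton N).eq_of_src (𝟙 N) 0,
      Abelian.Ext.mk₀_zero, Abelian.Ext.zero_comp]

lemma subsingleton_ext_of_linearEquiv {N N' : Type} [AddCommGroup N] [Module R N]
    [AddCommGroup N'] [Module R N'] (e : N ≃ₗ[R] N') (Y : ModuleCat.{0} R) (i : ℕ)
    (h : Subsingleton (Abelian.Ext (ModuleCat.of R N') Y i)) :
    Subsingleton (Abelian.Ext (ModuleCat.of R N) Y i) :=
  subsingleton_ext_X₂ (shortExact_of_function_exact (f := (0 : PUnit →ₗ[R] N))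
    (g := e.toLinearMap) (Function.injective_of_subsingleton _) e.surjective
    ((LinearMap.exact_zero_iff_injective _ _).2 e.injective)) Y i
    (subsingleton_ext_of_subsingleton (ModuleCat.of R PUnit) Y i) h

lemma isSMulRegular_of_equiv_quotient {N : Type} [AddCommGroup N] [Module R N] {p : Ideal R}
    [p.IsPrime] (e : N ≃ₗ[R] R ⧸ p) {x : R} (hx : x ∉ p) : IsSMulRegular N x := by
  refine (isSMulRegular_iff_right_eq_zero_of_smul).2 fun y hy ↦ ?_
  obtain ⟨a, ha⟩ := Ideal.Quotient.mk_surjective (e y)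
  have h : x • e y = 0 := by rw [← map_smul, hy, map_zero]
  rw [← ha, Algebra.smul_def, Ideal.Quotient.algebraMap_eq, ← map_mul,
    Ideal.Quotient.eq_zero_iff_mem] at h
  rw [← e.map_eq_zero_iff, ← ha, Ideal.Quotient.eq_zero_iff_mem]
  exact (Ideal.IsPrime.mem_or_mem ‹_› h).resolve_left hx

variable [IsNoetherianRing R]

lemma exists_injective_of_mem_minimalPrimes {p : Ideal R} (hp : p ∈ minimalPrimes R)
    {N : Type} [AddCommGroup N] [Module R N] [Module.Finite R N]
    (hN : Module.annihilator R N ≤ p) : ∃ f : R ⧸ p →ₗ[R] N, Function.Injective f := by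
  have hmin : p ∈ (Module.annihilator R N).minimalPrimes :=
    ⟨⟨hp.1.1, hN⟩, fun q hq hqp ↦ hp.2 ⟨hq.1, bot_le⟩ hqp⟩
  exact ((isAssociatedPrime_iff_exists_injective_linearMap p N).1
    (Module.associatedPrimes.minimalPrimes_annihilator_subset_associatedPrimes R N hmin)).2

/-- Higher Ext modules into a module of finite injective dimension vanish at minimal primes. -/
lemma exists_notMem_smul_ext_eq_zero {Y : ModuleCat.{0} R} {n : ℕ}
    (hn : ∀ i, n < i → ∀ N : ModuleCat.{0} R, Subsingleton (Abelian.Ext N Y i)) {p : Ideal R}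
    (hp : p ∈ minimalPrimes R) {i : ℕ} (hi : 0 < i) (N : Type) [AddCommGroup N] [Module R N]
    [hN : Module.Finite R N] : ∃ s ∉ p, ∀ x : Abelian.Ext (ModuleCat.of R N) Y i, s • x = 0 := by
  have hprime : p.IsPrime := hp.1.1
  by_cases hin : n < i
  · have := hn i hin (ModuleCat.of R N)
    exact ⟨1, p.one_notMem, fun x ↦ Subsingleton.elim _ _⟩
  · have ih (N' : Type) [AddCommGroup N'] [Module R N'] [Module.Finite R N'] :
        ∃ s ∉ p, ∀ x : Abelian.Ext (ModuleCat.of R N') Y (i + 1), s • x = 0 :=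
      exists_notMem_smul_ext_eq_zero hn hp i.succ_pos N'
    induction hN using IsNoetherianRing.induction_on_isQuotientEquivQuotientPrime R with
    | subsingleton N =>
      have := subsingleton_ext_of_subsingleton (ModuleCat.of R N) Y i
      exact ⟨1, p.one_notMem, fun x ↦ Subsingleton.elim _ _⟩
    | quotient N q e =>
      by_cases hq : q.1 ≤ p
      · obtain rfl : q.1 = p := hq.antisymm (hp.2 ⟨q.2, bot_le⟩ hq)
        obtain ⟨f, hf⟩ := exists_injective_of_mem_minimalPrimes hp (N := R)
          (by simp [Module.annihilator_eq_bot.2])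
        have hS := shortExact_of_function_exact (f := f ∘ₗ e.toLinearMap) (hf.comp e.injective)
          (Submodule.mkQ_surjective _) (LinearMap.exact_map_mkQ_range _)
        obtain ⟨s, hs, h⟩ := ih (R ⧸ LinearMap.range (f ∘ₗ e.toLinearMap))
        refine ⟨s, hs, fun x ↦ ?_⟩
        obtain ⟨y, hy⟩ := Abelian.Ext.contravariant_sequence_exact₁ hS Y (s • x) (add_comm 1 i)
          (by rw [Abelian.Ext.comp_smul]; exact h _)
        have : HasProjectiveDimensionLT (ModuleCat.of R R) 1 :=
          projective_iff_hasProjectiveDimensionLT_one.1 inferInstance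
        have hR := HasProjectiveDimensionLT.subsingleton (ModuleCat.of R R) 1 i hi Y
        rw [← hy, show y = 0 from hR.elim _ _, Abelian.Ext.comp_zero]
      · obtain ⟨s, hsq, hsp⟩ := Set.not_subset.1 hq
        refine ⟨s, hsp, smul_ext_eq_zero_of_mem_annihilator_left Y i ?_⟩
        change s ∈ Module.annihilator R N
        rwa [e.annihilator_eq, Ideal.annihilator_quotient]
    | exact N₁ N₂ N₃ f g hf hg hfg h₁ h₃ =>
      obtain ⟨s₁, hs₁, h₁⟩ := h₁
      obtain ⟨s₃, hs₃, h₃⟩ := h₃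
      refine ⟨s₃ * s₁, hprime.mul_notMem hs₃ hs₁, fun x ↦ ?_⟩
      have hS := shortExact_of_function_exact hf hg hfg
      obtain ⟨y, hy⟩ := Abelian.Ext.contravariant_sequence_exact₂ hS Y (s₁ • x)
        (by rw [Abelian.Ext.comp_smul]; exact h₁ _)
      rw [mul_smul, ← hy, ← Abelian.Ext.comp_smul, show s₃ • y = 0 from h₃ y,
        Abelian.Ext.comp_zero]
termination_by n + 1 - i

variable [IsLocalRing R]

lemma subsingleton_ext_of_quotSMulTop {N : Type} [AddCommGroup N] [Module R N]
    [Module.Finite R N] {x : R} (hx : x ∈ maximalIdeal R) (hreg : IsSMulRegular N x)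
    (Y : ModuleCat.{0} R) [Module.Finite R Y] (i : ℕ)
    (h : Subsingleton (Abelian.Ext (ModuleCat.of R (QuotSMulTop x N)) Y (i + 1))) :
    Subsingleton (Abelian.Ext (ModuleCat.of R N) Y i) := by
  have hreg' : IsSMulRegular (ModuleCat.of R N) x := hreg
  have htop : (⊤ : Submodule R (Abelian.Ext (ModuleCat.of R N) Y i)) ≤ maximalIdeal R • ⊤ := by
    intro z _
    obtain ⟨y, hy⟩ := exists_mk₀_f_comp_eq hreg'.smulShortComplex_shortExact Y i h z
    rw [ModuleCat.smulShortComplex_f_eq_smul_id] at hy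
    rw [← hy]
    exact (mk₀_smul_id_comp Y i x y).symm ▸ Submodule.smul_mem_smul hx trivial
  have := Submodule.eq_bot_of_le_smul_of_le_jacobson_bot (maximalIdeal R) ⊤ Module.Finite.fg_top
    htop (maximalIdeal_le_jacobson ⊥)
  exact (Submodule.subsingleton_iff R).1 (subsingleton_of_bot_eq_top this.symm)

/-- Ischebeck vanishing: `Ext^i(N, Y) = 0` for `i + dim N < d` when `depth Y ≥ d`. -/
lemma subsingleton_ext_of_supportDim_lt {d : ℕ} (Y : ModuleCat.{0} R) [Module.Finite R Y]
    (hY : ∀ i < d, Subsingleton (Abelian.Ext (ModuleCat.of R (ResidueField R)) Y i)) (n : ℕ)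
    (N : Type) [AddCommGroup N] [Module R N] [hN : Module.Finite R N]
    (hdim : Module.supportDim R N < n) (i : ℕ) (hi : i + n ≤ d) :
    Subsingleton (Abelian.Ext (ModuleCat.of R N) Y i) := by
  induction n generalizing N i with
  | zero =>
    have : Subsingleton N := by
      by_contra h
      have := not_subsingleton_iff_nontrivial.1 h
      have : Nonempty (Module.support R N) := (Module.nonempty_support_of_nontrivial).to_subtype
      exact hdim.not_ge (by simpa [Module.supportDim] using Order.krullDim_nonneg)
    exact subsingleton_ext_of_subsingleton (ModuleCat.of R N) Y i
  | succ n ih =>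
    induction hN using IsNoetherianRing.induction_on_isQuotientEquivQuotientPrime R with
    | subsingleton N => exact subsingleton_ext_of_subsingleton (ModuleCat.of R N) Y i
    | quotient N p e =>
      by_cases hp : maximalIdeal R ≤ p.1
      · have hp' : p.1 = maximalIdeal R :=
          (((maximalIdeal.isMaximal R).eq_of_le p.2.ne_top hp)).symm
        exact subsingleton_ext_of_linearEquiv
          (e.trans (Submodule.quotEquivOfEq _ _ hp')) Y i (hY i (by omega))
      · obtain ⟨x, hx, hxp⟩ := Set.not_subset.1 hp
        have hreg := isSMulRegular_of_equiv_quotient e hxp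
        refine subsingleton_ext_of_quotSMulTop hx hreg Y i (ih _ ?_ _ (by omega))
        rw [← Module.supportDim_quotSMulTop_succ_eq_supportDim hreg hx] at hdim
        by_contra h
        exact hdim.not_ge (by simpa using add_le_add_left (not_lt.1 h) 1)
    | exact N₁ N₂ N₃ f g hf hg hfg h₁ h₃ =>
      exact subsingleton_ext_X₂ (shortExact_of_function_exact hf hg hfg) Y i
        (h₁ ((Module.supportDim_le_of_injective f hf).trans_lt hdim))
        (h₃ ((Module.supportDim_le_of_surjective g hg).trans_lt hdim))

end FiniteModule

section CanonicalModule

open IsLocalRing Pointwise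

variable {R : Type} [CommRing R] [IsNoetherianRing R] [IsLocalRing R]

lemma exists_injective_residueField_hom {N : Type} [AddCommGroup N] [Module R N]
    [Module.Finite R N] (hN : Module.supportDim R N = 0) :
    ∃ f : ResidueField R →ₗ[R] N, Function.Injective f := by
  have hne : Nontrivial N := by simp [← Module.supportDim_ne_bot_iff_nontrivial R, hN]
  obtain ⟨p, hp⟩ := associatedPrimes.nonempty R N
  have hpp := hp.1
  have hsupp : (⟨p, hpp⟩ : PrimeSpectrum R) ∈ Module.support R N := by
    rw [Module.support_eq_zeroLocus]
    simpa [Submodule.annihilator_top] using hp.annihilator_le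
  rw [support_of_supportDim_eq_zero R N hN] at hsupp
  obtain rfl : maximalIdeal R = p :=
    (maximalIdeal.isMaximal R).eq_of_le hpp.ne_top ((PrimeSpectrum.mem_zeroLocus _ _).1 hsupp)
  exact ((isAssociatedPrime_iff_exists_injective_linearMap _ N).1 hp).2

variable {d : ℕ}

/-- Over a Cohen-Macaulay local ring the residue field embeds into a module of projective
dimension at most `dim R`. -/
lemma exists_injective_hom_and_hasProjectiveDimensionLT (hdim : ringKrullDim R = d)
    (hR : ∀ i < d, Subsingleton (Abelian.Ext (ModuleCat.of R (ResidueField R))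
      (ModuleCat.of R R) i)) :
    ∃ (N : ModuleCat.{0} R) (_ : Module.Finite R N) (f : ResidueField R →ₗ[R] N),
      Function.Injective f ∧ HasProjectiveDimensionLT N (d + 1) := by
  obtain ⟨rs, hlen, hmem, hreg⟩ := ModuleCat.exists_isRegular_of_exists_subsingleton_ext
    (maximalIdeal R) d (ModuleCat.of R R)
    (by simpa [lt_top_iff_ne_top] using Ideal.IsPrime.ne_top') (ModuleCat.of R (ResidueField R))
    (by
      change Module.support R (R ⧸ maximalIdeal R) = _
      rw [Module.support_eq_zeroLocus, Ideal.annihilator_quotient]) hR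
  replace hreg : RingTheory.Sequence.IsRegular R rs := hreg
  have h0 : Module.supportDim R (R ⧸ Ideal.ofList rs) = 0 := by
    rw [Module.supportDim_quotient_eq_ringKrullDim]
    have := ringKrullDim_add_length_eq_ringKrullDim_of_isRegular rs hreg
    rw [hlen, hdim] at this
    exact (ENat.WithBot.add_natCast_cancel (c := d)).1 (by rw [this, zero_add])
  obtain ⟨f, hf⟩ := exists_injective_residueField_hom h0
  refine ⟨ModuleCat.of R (Shrink.{0} (R ⧸ Ideal.ofList rs)),
    Module.Finite.equiv (Shrink.linearEquiv R _).symm,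
    (Shrink.linearEquiv R _).symm.toLinearMap ∘ₗ f,
    (Shrink.linearEquiv R _).symm.injective.comp hf, ?_⟩
  exact (projectiveDimension_le_iff _ d).1
    (hlen ▸ ModuleCat.projectiveDimension_quotient_eq_length rs hreg).le

variable {Y : ModuleCat.{0} R} [Module.Finite R Y]

/-- Over a Cohen-Macaulay local ring, finite injective dimension is at most `dim R`. -/
lemma subsingleton_ext_of_injectiveDimension_bound (hdim : ringKrullDim R = d)
    (hR : ∀ i < d, Subsingleton (Abelian.Ext (ModuleCat.of R (ResidueField R))
      (ModuleCat.of R R) i)) {n : ℕ}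
    (hn : ∀ i, n < i → ∀ N : ModuleCat.{0} R, Subsingleton (Abelian.Ext N Y i))
    (N : Type) [AddCommGroup N] [Module R N] [hN : Module.Finite R N] {i : ℕ} (hi : d < i) :
    Subsingleton (Abelian.Ext (ModuleCat.of R N) Y i) := by
  by_cases hin : n < i
  · exact hn i hin _
  · have ih (N' : Type) [AddCommGroup N'] [Module R N'] [Module.Finite R N'] :
        Subsingleton (Abelian.Ext (ModuleCat.of R N') Y (i + 1)) :=
      subsingleton_ext_of_injectiveDimension_bound hdim hR hn N' (hi.trans i.lt_succ_self)
    induction hN using IsNoetherianRing.induction_on_isQuotientEquivQuotientPrime R with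
    | subsingleton N => exact subsingleton_ext_of_subsingleton (ModuleCat.of R N) Y i
    | quotient N p e =>
      by_cases hp : maximalIdeal R ≤ p.1
      · have hp' : p.1 = maximalIdeal R :=
          ((maximalIdeal.isMaximal R).eq_of_le p.2.ne_top hp).symm
        obtain ⟨L, _, f, hf, _⟩ := exists_injective_hom_and_hasProjectiveDimensionLT hdim hR
        exact subsingleton_ext_of_linearEquiv (e.trans (Submodule.quotEquivOfEq _ _ hp')) Y i
          (subsingleton_ext_X₁ (shortExact_of_function_exact hf (Submodule.mkQ_surjective _)
            (LinearMap.exact_map_mkQ_range f)) Y i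
            (HasProjectiveDimensionLT.subsingleton L (d + 1) i hi Y) (ih _))
      · obtain ⟨x, hx, hxp⟩ := Set.not_subset.1 hp
        exact subsingleton_ext_of_quotSMulTop hx (isSMulRegular_of_equiv_quotient e hxp) Y i (ih _)
    | exact N₁ N₂ N₃ f g hf hg hfg h₁ h₃ =>
      exact subsingleton_ext_X₂ (shortExact_of_function_exact hf hg hfg) Y i h₁ h₃
termination_by n + 1 - i

lemma not_subsingleton_ext_of_supportDim_lt_one
    (hY : ∀ i < d, Subsingleton (Abelian.Ext (ModuleCat.of R (ResidueField R)) Y i))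
    (hk : ¬ Subsingleton (Abelian.Ext (ModuleCat.of R (ResidueField R)) Y d))
    (N : Type) [AddCommGroup N] [Module R N] [Module.Finite R N] [Nontrivial N]
    (hN : Module.supportDim R N < 1) : ¬ Subsingleton (Abelian.Ext (ModuleCat.of R N) Y d) := by
  obtain ⟨C, hC, -⟩ := (eq_top_or_exists_le_coatom (⊥ : Submodule R N)).resolve_left bot_ne_top
  obtain ⟨I, hI, ⟨e⟩⟩ := isSimpleModule_iff_quot_maximal.1 (isSimpleModule_iff_isCoatom.2 hC)
  obtain rfl := eq_maximalIdeal hI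
  intro h
  refine hk (subsingleton_ext_of_linearEquiv e.symm Y d (subsingleton_of_forall_eq 0 fun x ↦ ?_))
  exact eq_zero_of_mk₀_g_comp_eq_zero (shortExact_of_function_exact C.injective_subtype
    C.mkQ_surjective (LinearMap.exact_subtype_mkQ C)) Y d
    (fun j hj ↦ subsingleton_ext_of_supportDim_lt Y hY 1 C
      (by simpa using (Module.supportDim_le_of_injective _ C.injective_subtype).trans_lt hN) j hj)
    x (Subsingleton.elim _ _)

lemma smul_eq_zero_of_supportDim_lt_one (hdim : ringKrullDim R = d)
    (hR : ∀ i < d, Subsingleton (Abelian.Ext (ModuleCat.of R (ResidueField R))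
      (ModuleCat.of R R) i))
    (hY : ∀ i < d, Subsingleton (Abelian.Ext (ModuleCat.of R (ResidueField R)) Y i))
    (hk : ¬ Subsingleton (Abelian.Ext (ModuleCat.of R (ResidueField R)) Y d)) {n : ℕ}
    (hn : ∀ i, n < i → ∀ N : ModuleCat.{0} R, Subsingleton (Abelian.Ext N Y i)) {a : R}
    (ha : a ∈ Module.annihilator R Y) {N : Type} [AddCommGroup N] [Module R N]
    [Module.Finite R N] (hN : Module.supportDim R N < 1) (x : N) : a • x = 0 := by
  let φ : N →ₗ[R] N := LinearMap.lsmul R N a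
  by_contra hx
  have hφ : Nontrivial (LinearMap.range φ) :=
    ⟨⟨φ x, x, rfl⟩, 0, fun h ↦ hx (congrArg Subtype.val h)⟩
  have hrange := Module.supportDim_le_of_injective _ (LinearMap.range φ).injective_subtype
  refine not_subsingleton_ext_of_supportDim_lt_one hY hk (LinearMap.range φ)
    (hrange.trans_lt hN) (subsingleton_of_forall_eq 0 fun z ↦ ?_)
  refine eq_zero_of_mk₀_g_comp_eq_zero (shortExact_of_function_exact
    (LinearMap.ker φ).injective_subtype φ.surjective_rangeRestrict
    (by rw [LinearMap.exact_iff, LinearMap.ker_rangeRestrict, Submodule.range_subtype])) Y d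
    (fun j hj ↦ subsingleton_ext_of_supportDim_lt Y hY 1 _ (by simpa using
      (Module.supportDim_le_of_injective _ (LinearMap.ker φ).injective_subtype).trans_lt hN) j hj)
    z ?_
  obtain ⟨y, rfl⟩ := exists_mk₀_f_comp_eq (shortExact_of_function_exact
    (LinearMap.range φ).injective_subtype (LinearMap.range φ).mkQ_surjective
    (LinearMap.exact_subtype_mkQ _)) Y d
    (subsingleton_ext_of_injectiveDimension_bound hdim hR hn _ d.lt_succ_self) z
  rw [Abelian.Ext.mk₀_comp_mk₀_assoc]
  refine Eq.trans ?_ (smul_ext_eq_zero_of_mem_annihilator_right d ha y)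
  rw [← mk₀_smul_id_comp]
  rfl

/-- A maximal Cohen-Macaulay module of finite injective dimension with `Ext^d(k, Y) ≠ 0` is
faithful. -/
lemma annihilator_eq_bot_of_injectiveDimension_bound (hdim : ringKrullDim R = d)
    (hR : ∀ i < d, Subsingleton (Abelian.Ext (ModuleCat.of R (ResidueField R))
      (ModuleCat.of R R) i))
    (hY : ∀ i < d, Subsingleton (Abelian.Ext (ModuleCat.of R (ResidueField R)) Y i))
    (hk : ¬ Subsingleton (Abelian.Ext (ModuleCat.of R (ResidueField R)) Y d)) {n : ℕ}
    (hn : ∀ i, n < i → ∀ N : ModuleCat.{0} R, Subsingleton (Abelian.Ext N Y i)) :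
    Module.annihilator R Y = ⊥ := by
  rw [← le_bot_iff, ← Ideal.iInf_pow_eq_bot_of_isLocalRing (maximalIdeal R)
    Ideal.IsPrime.ne_top', le_iInf_iff]
  intro m a ha
  have hsub : Subsingleton (Module.support R (R ⧸ maximalIdeal R ^ m)) := by
    have h (p : PrimeSpectrum R) (hp : p ∈ Module.support R (R ⧸ maximalIdeal R ^ m)) :
        p = closedPoint R := by
      rw [Module.support_eq_zeroLocus, Ideal.annihilator_quotient] at hp
      exact PrimeSpectrum.ext ((maximalIdeal.isMaximal R).eq_of_le p.2.ne_top
        (p.2.le_of_pow_le hp)).symm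
    exact ⟨fun p q ↦ Subtype.ext ((h p p.2).trans (h q q.2).symm)⟩
  have := smul_eq_zero_of_supportDim_lt_one hdim hR hY hk hn ha
    (N := R ⧸ maximalIdeal R ^ m) (Order.krullDim_nonpos_of_subsingleton.trans_lt zero_lt_one) 1
  rwa [Algebra.smul_def, mul_one, Ideal.Quotient.algebraMap_eq,
    Ideal.Quotient.eq_zero_iff_mem] at this

end CanonicalModule

section Preenvelope

open IsLocalRing

variable {R : Type} [CommRing R]

lemma exists_linearMap_comp_eq_of_subsingleton_ext {N₁ N₂ Z : Type} [AddCommGroup N₁] [Module R N₁]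
    [AddCommGroup N₂] [Module R N₂] [AddCommGroup Z] [Module R Z] {f : N₁ →ₗ[R] N₂}
    (hf : Function.Injective f)
    (hZ : Subsingleton (ext1 R 1 (N₂ ⧸ LinearMap.range f) Z)) (u : N₁ →ₗ[R] Z) :
    ∃ v : N₂ →ₗ[R] Z, v ∘ₗ f = u := by
  obtain ⟨y, hy⟩ := exists_mk₀_f_comp_eq (shortExact_of_function_exact hf
    (Submodule.mkQ_surjective _) (LinearMap.exact_map_mkQ_range f)) (ModuleCat.of R Z) 0
    ((subsingleton_abelianExt_iff_subsingleton_ext _ _ 1).2 hZ)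
    (Abelian.Ext.mk₀ (ModuleCat.ofHom u))
  obtain ⟨v, rfl⟩ := (Abelian.Ext.mk₀_bijective _ _).2 y
  rw [Abelian.Ext.mk₀_comp_mk₀] at hy
  exact ⟨v.hom, congrArg ModuleCat.Hom.hom ((Abelian.Ext.mk₀_bijective _ _).1 hy)⟩

lemma subsingleton_ext_residueField_of_le_rdepth [IsLocalRing R] {d : ℕ} {N : Type}
    [AddCommGroup N] [Module R N] (hN : (d : ℕ∞) ≤ rdepth R N) (i : ℕ) (hi : i < d) :
    Subsingleton (Abelian.Ext (ModuleCat.of R (ResidueField R)) (ModuleCat.of R N) i) := by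
  rw [subsingleton_abelianExt_iff_subsingleton_ext]
  by_contra h
  exact (hN.trans (sInf_le ⟨i, rfl, h⟩)).not_gt (by exact_mod_cast hi)

lemma exists_mem_minimalPrimes_of_le_ringKrullDim_quotient {d : ℕ} (hdim : ringKrullDim R = d)
    {I : Ideal R} (hI : (d : WithBot ℕ∞) ≤ ringKrullDim (R ⧸ I)) :
    ∃ p ∈ minimalPrimes R, I ≤ p := by
  rw [ringKrullDim_quotient] at hI
  obtain ⟨l, hl⟩ := Order.le_krullDim_iff.1 hI
  refine ⟨l.head.1.asIdeal, ?_, l.head.2⟩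
  obtain ⟨q, hq, hql⟩ := Ideal.exists_minimalPrimes_le (I := ⊥) (J := l.head.1.asIdeal) bot_le
  obtain rfl | hlt := eq_or_lt_of_le hql
  · exact hq
  · have hlen : ((d + 1 : ℕ) : WithBot ℕ∞) ≤ ringKrullDim R :=
      Order.le_krullDim_iff.2 ⟨(l.map Subtype.val fun _ _ h ↦ h).cons ⟨q, hq.1.1⟩ hlt,
        (RelSeries.cons_length ..).trans (congrArg (· + 1) hl)⟩
    rw [hdim] at hlen
    exact absurd (by exact_mod_cast hlen) d.not_succ_le_self

variable [IsNoetherianRing R] [IsLocalRing R] {d : ℕ} {M X : Type} [AddCommGroup M] [Module R M]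
  [AddCommGroup X] [Module R X] [Module.Finite R M]

lemma exists_comp_eq_of_codGT_ker {μ : M →ₗ[R] X} (hμ : codGT R d (LinearMap.ker μ) 0) {Z : Type}
    [AddCommGroup Z] [Module R Z] (hZ : IsMCM R d Z)
    (hext : Subsingleton (ext1 R 1 (X ⧸ LinearMap.range μ) Z)) (f : M →ₗ[R] Z) :
    ∃ g : X →ₗ[R] Z, g ∘ₗ μ = f := by
  have := hZ.1
  have hdimK : Module.supportDim R (LinearMap.ker μ) < d := by
    rw [Module.supportDim_eq_ringKrullDim_quotient_annihilator]
    simpa [codGT, mdim] using hμ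
  have hhom := subsingleton_ext_of_supportDim_lt (ModuleCat.of R Z)
    (subsingleton_ext_residueField_of_le_rdepth hZ.2) d (LinearMap.ker μ) hdimK 0 (by simp)
  have hker : LinearMap.ker μ ≤ LinearMap.ker f := by
    intro x hx
    have h : ModuleCat.ofHom (f ∘ₗ (LinearMap.ker μ).subtype) = 0 :=
      (Abelian.Ext.mk₀_bijective _ _).1 (hhom.elim _ _)
    exact LinearMap.congr_fun (congrArg ModuleCat.Hom.hom h) ⟨x, hx⟩
  let ι := (LinearMap.ker μ).liftQ μ le_rfl
  have hι : LinearMap.range ι = LinearMap.range μ := Submodule.range_liftQ _ _ _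
  obtain ⟨g, hg⟩ := exists_linearMap_comp_eq_of_subsingleton_ext (f := ι)
    (LinearMap.ker_eq_bot.1 (Submodule.ker_liftQ_eq_bot _ _ _ le_rfl)) (hι ▸ hext)
    ((LinearMap.ker μ).liftQ f hker)
  exact ⟨g, LinearMap.ext fun x ↦ LinearMap.congr_fun hg (Submodule.Quotient.mk x)⟩

lemma codGT_ker_of_isCMPreenvelope (hdim : ringKrullDim R = d) (hCM : (d : ℕ∞) ≤ rdepth R R)
    {ω : Type} [AddCommGroup ω] [Module R ω] (hω : IsCanonicalModule R d ω) {μ : M →ₗ[R] X}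
    (hμ : IsCMPreenvelope R d μ) : codGT R d (LinearMap.ker μ) 0 := by
  obtain ⟨⟨hfin, hdepth⟩, ⟨n, hn⟩, ⟨e⟩⟩ := hω
  by_contra hcod
  obtain ⟨p, hp, hKp⟩ := exists_mem_minimalPrimes_of_le_ringKrullDim_quotient hdim
    (I := Module.annihilator R (LinearMap.ker μ)) (by simpa [codGT, mdim] using hcod)
  have hn' (i : ℕ) (hi : n < i) (N : ModuleCat.{0} R) :
      Subsingleton (Abelian.Ext N (ModuleCat.of R ω) i) :=
    (subsingleton_abelianExt_iff_subsingleton_ext _ _ i).2 (hn N i hi)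
  have hk : ¬ Subsingleton
      (Abelian.Ext (ModuleCat.of R (ResidueField R)) (ModuleCat.of R ω) d) := by
    rw [subsingleton_abelianExt_iff_subsingleton_ext]
    intro h
    exact not_subsingleton (ResidueField R) (e.toEquiv.subsingleton_congr.1 h)
  have hann : Module.annihilator R ω = ⊥ := annihilator_eq_bot_of_injectiveDimension_bound
    (Y := ModuleCat.of R ω) hdim (subsingleton_ext_residueField_of_le_rdepth hCM)
    (subsingleton_ext_residueField_of_le_rdepth hdepth) hk hn'
  obtain ⟨f, hf⟩ := exists_injective_of_mem_minimalPrimes hp hKp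
  obtain ⟨g, hg⟩ := exists_injective_of_mem_minimalPrimes hp (N := ω) (hann ▸ bot_le)
  have hj : Function.Injective ((LinearMap.ker μ).subtype ∘ₗ f) :=
    Subtype.val_injective.comp hf
  have hS := shortExact_of_function_exact hj (Submodule.mkQ_surjective _)
    (LinearMap.exact_map_mkQ_range _)
  obtain ⟨s, hs, hsmul⟩ := exists_notMem_smul_ext_eq_zero hn' hp one_pos
    (M ⧸ LinearMap.range ((LinearMap.ker μ).subtype ∘ₗ f))
  obtain ⟨y, hy⟩ := Abelian.Ext.contravariant_sequence_exact₁ hS (ModuleCat.of R ω)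
    (s • Abelian.Ext.mk₀ (ModuleCat.ofHom g)) (add_comm 1 0)
    (by rw [Abelian.Ext.comp_smul]; exact hsmul _)
  obtain ⟨h, rfl⟩ := (Abelian.Ext.mk₀_bijective _ _).2 y
  rw [Abelian.Ext.mk₀_comp_mk₀, ← Abelian.Ext.mk₀_smul] at hy
  have hy' := LinearMap.congr_fun (congrArg ModuleCat.Hom.hom
    ((Abelian.Ext.mk₀_bijective _ _).1 hy)) (1 : R ⧸ p)
  obtain ⟨v, hv⟩ := hμ.2 ω ⟨hfin, hdepth⟩ h.hom
  have hzero : h.hom (f 1 : M) = 0 := by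
    rw [← hv, LinearMap.comp_apply, LinearMap.mem_ker.1 (f 1).2, map_zero]
  have hgs : s • g 1 = 0 := hy'.symm.trans hzero
  rw [← map_smul, map_eq_zero_iff g hg, Algebra.smul_def, mul_one,
    Ideal.Quotient.algebraMap_eq, Ideal.Quotient.eq_zero_iff_mem] at hgs
  exact hs hgs

end Preenvelope

/-- `μ : M → X` with `X` maximal Cohen-Macaulay is a special CM-preenvelope
iff `cod (ker μ) > 0` and `Ext^1(coker μ, Z) = 0` for every maximal Cohen-Macaulay `Z`. -/
theorem special_cm_preenvelope_iff (R : Type) [CommRing R] [IsNoetherianRing R] [IsLocalRing R]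
    (d : ℕ) (hdim : ringKrullDim R = d) (hCM : (d : ℕ∞) ≤ rdepth R R)
    (ω : Type) [AddCommGroup ω] [Module R ω] (hω : IsCanonicalModule R d ω)
    (M X : Type) [AddCommGroup M] [Module R M] [AddCommGroup X] [Module R X]
    [Module.Finite R M] (hX : IsMCM R d X) (μ : M →ₗ[R] X) :
    IsSpecialCMPreenvelope R d μ ↔
      codGT R d ↥(LinearMap.ker μ) 0 ∧
        ∀ (Z : Type) [AddCommGroup Z] [Module R Z], IsMCM R d Z →
          Subsingleton (ext1 R 1 (X ⧸ LinearMap.range μ) Z) := by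
  refine ⟨fun h ↦ ⟨codGT_ker_of_isCMPreenvelope hdim hCM hω h.1, h.2⟩, fun h ↦ ⟨⟨hX, ?_⟩, h.2⟩⟩
  intro Z _ _ hZ f
  exact exists_comp_eq_of_codGT_ker h.1 hZ (h.2 Z hZ) f
end

section
/- Let μ : M → X be a homomorphism of finitely generated R-modules with X maximal Cohen–Macaulay. Then μ is a special CM-preenvelope of M if and only if cod(ker μ) > 0 and there exists an exact sequence 0 → S → coker μ → T → U → 0 of finitely generated R-modules such that cod S > 1, cod U > 2, T satisfies (S_2), and T† has finite injective dimension and satisfies (S_3). -/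
open CategoryTheory

namespace CategoryTheory.ProjectiveResolution

open Abelian

variable {A : Type} [CommRing A] {X Y : ModuleCat.{0} A} (P : ProjectiveResolution X)

lemma smul_extMk {n : ℕ} (r : A) (f : P.complex.X n ⟶ Y) (m : ℕ) (hm : n + 1 = m)
    (hf : P.complex.d m n ≫ f = 0) :
    r • P.extMk f m hm hf = P.extMk (r • f) m hm (by simp [hf]) := by
  rw [Ext.smul_eq_comp_mk₀, extMk_comp_mk₀]
  congr 1

lemma extMk_zero_eq_zero_iff (f : P.complex.X 0 ⟶ Y) (m : ℕ) (hm : 0 + 1 = m)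
    (hf : P.complex.d m 0 ≫ f = 0) :
    P.extMk f m hm hf = 0 ↔ f = 0 := by
  refine ⟨fun h ↦ ?_, fun h ↦ by subst h; simp⟩
  rw [← P.extEquivCohomologyClass.apply_eq_iff_eq,
    extEquivCohomologyClass_extMk, extEquivCohomologyClass_zero,
    CochainComplex.HomComplex.CohomologyClass.mk_eq_zero_iff,
    CochainComplex.HomComplex.Cocycle.toSingleMk_mem_coboundaries_iff _ _ _ _ _ 1 (by lia)] at h
  obtain ⟨g, hg⟩ := h
  have hz : P.cochainComplex.d ((-(0 : ℕ) : ℤ)) 1 = 0 :=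
    (P.cochainComplex.isZero_of_isStrictlyLE 0 1 (by lia)).eq_of_tgt _ _
  rw [hz, Limits.zero_comp] at hg
  rw [← cancel_epi (P.cochainComplexXIso (-(0 : ℕ)) 0 rfl).hom, ← hg, Limits.comp_zero]

lemma extMk_eq_zero_iff_prev {n : ℕ} (f : P.complex.X n ⟶ Y) (m : ℕ) (hm : n + 1 = m)
    (hf : P.complex.d m n ≫ f = 0) :
    P.extMk f m hm hf = 0 ↔
      ∃ g : P.complex.X ((ComplexShape.up ℕ).prev n) ⟶ Y,
        P.complex.d n ((ComplexShape.up ℕ).prev n) ≫ g = f := by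
  rcases n with _ | p
  · rw [extMk_zero_eq_zero_iff]
    constructor
    · rintro rfl
      exact ⟨0, by simp⟩
    · rintro ⟨g, rfl⟩
      rw [P.complex.shape _ _ (by simp), Limits.zero_comp]
  · rw [extMk_eq_zero_iff P f m hm hf ((ComplexShape.up ℕ).prev (p + 1)) (by simp)]

/-- Assigning to a cocycle its class in `Ext`, as a linear map. -/
noncomputable def cocycleToExt (n : ℕ) :
    LinearMap.ker ((P.complex.linearYonedaObj A Y).sc n).g.hom →ₗ[A] Ext.{0} X Y n where
  toFun x := P.extMk (show P.complex.X n ⟶ Y from x.1) ((ComplexShape.up ℕ).next n) (by simp)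
    (show ((P.complex.linearYonedaObj A Y).sc n).g.hom x.1 = 0 from x.2)
  map_add' x y := (P.add_extMk _ _ _ _ _ _).symm
  map_smul' r x := (P.smul_extMk _ _ _ _ _).symm

lemma cocycleToExt_surjective (n : ℕ) : Function.Surjective (P.cocycleToExt (Y := Y) n) := by
  intro α
  obtain ⟨f, hf, h⟩ := P.extMk_surjective α ((ComplexShape.up ℕ).next n) (by simp)
  exact ⟨⟨f, hf⟩, h⟩

lemma ker_cocycleToExt (n : ℕ) : LinearMap.ker (P.cocycleToExt (Y := Y) n) =
    LinearMap.range ((P.complex.linearYonedaObj A Y).sc n).moduleCatToCycles := by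
  ext x
  rw [LinearMap.mem_ker]
  refine (P.extMk_eq_zero_iff_prev (show P.complex.X n ⟶ Y from x.1)
    ((ComplexShape.up ℕ).next n) (by simp)
    (show ((P.complex.linearYonedaObj A Y).sc n).g.hom x.1 = 0 from x.2)).trans ?_
  constructor
  · rintro ⟨g, hg⟩
    exact ⟨g, Subtype.ext hg⟩
  · rintro ⟨g, hg⟩
    exact ⟨g, congrArg Subtype.val hg⟩

/-- The derived functor `Ext` and the `Ext` defined by the derived category agree. -/
noncomputable def extLinearEquiv (n : ℕ) :
    (((_root_.Ext A (ModuleCat A) n).obj (Opposite.op X)).obj Y) ≃ₗ[A] Ext.{0} X Y n :=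
  (P.isoExt n Y ≪≫ ((P.complex.linearYonedaObj A Y).sc n).moduleCatHomologyIso).toLinearEquiv ≪≫ₗ
    Submodule.quotEquivOfEq _ _ (P.ker_cocycleToExt n).symm ≪≫ₗ
    (P.cocycleToExt n).quotKerEquivOfSurjective (P.cocycleToExt_surjective n)

end CategoryTheory.ProjectiveResolution

/-- `Ext^n_A(M, N)` defined via the derived category. -/
abbrev ExtMod (A : Type) [CommRing A] (M N : Type) [AddCommGroup M] [Module A M]
    [AddCommGroup N] [Module A N] (n : ℕ) : Type :=
  Abelian.Ext.{0} (ModuleCat.of A M) (ModuleCat.of A N) n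

/-- `ext1` agrees with the `Ext` defined via the derived category. -/
noncomputable def ext1LinearEquiv (A : Type) [CommRing A] (M N : Type) [AddCommGroup M] [Module A M]
    [AddCommGroup N] [Module A N] (n : ℕ) : ext1 A n M N ≃ₗ[A] ExtMod A M N n :=
  (projectiveResolution (ModuleCat.of A M)).extLinearEquiv n

section ExtSequences

variable {A : Type} [CommRing A]
  {M' M M'' N' N N'' : Type} [AddCommGroup M'] [Module A M'] [AddCommGroup M] [Module A M]
  [AddCommGroup M''] [Module A M''] [AddCommGroup N'] [Module A N'] [AddCommGroup N] [Module A N]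
  [AddCommGroup N''] [Module A N'']

/-- The sequence `0 → M' → M → M'' → 0` is exact. -/
structure IsSES (f : M' →ₗ[A] M) (g : M →ₗ[A] M'') : Prop where
  inj : Function.Injective f
  exact : Function.Exact f g
  surj : Function.Surjective g

lemma isSES_ker {g : M →ₗ[A] M''} (hg : Function.Surjective g) :
    IsSES (LinearMap.ker g).subtype g :=
  ⟨Subtype.val_injective, g.exact_subtype_ker_map, hg⟩

lemma isSES_mkQ (K : Submodule A M) : IsSES K.subtype K.mkQ :=
  ⟨Subtype.val_injective, LinearMap.exact_subtype_mkQ K, K.mkQ_surjective⟩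

lemma isSES_range {f : M' →ₗ[A] M} (hf : Function.Injective f) :
    IsSES f (LinearMap.range f).mkQ :=
  ⟨hf, f.exact_map_mkQ_range, Submodule.mkQ_surjective _⟩

/-- The short complex of an exact sequence of linear maps. -/
abbrev IsSES.complex {f : M' →ₗ[A] M} {g : M →ₗ[A] M''} (h : IsSES f g) :
    ShortComplex (ModuleCat.{0} A) :=
  ModuleCat.shortComplexOfCompEqZero f g h.exact.linearMap_comp_eq_zero

lemma IsSES.shortExact {f : M' →ₗ[A] M} {g : M →ₗ[A] M''} (h : IsSES f g) :
    h.complex.ShortExact :=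
  ModuleCat.shortComplex_shortExact _ h.exact h.inj h.surj

/-- Precomposition with a linear map, on `Ext`. -/
noncomputable def extPre (f : M' →ₗ[A] M) (N : Type) [AddCommGroup N] [Module A N] (n : ℕ) :
    ExtMod A M N n →ₗ[A] ExtMod A M' N n :=
  (Abelian.Ext.mk₀ (ModuleCat.ofHom f)).precompOfLinear A _ (zero_add n)

/-- Postcomposition with a linear map, on `Ext`. -/
noncomputable def extPost (M : Type) [AddCommGroup M] [Module A M] (g : N' →ₗ[A] N) (n : ℕ) :
    ExtMod A M N' n →ₗ[A] ExtMod A M N n :=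
  (Abelian.Ext.mk₀ (ModuleCat.ofHom g)).postcompOfLinear A _ (add_zero n)

/-- The connecting map in the first variable. -/
noncomputable def IsSES.extδ {f : M' →ₗ[A] M} {g : M →ₗ[A] M''} (h : IsSES f g)
    (N : Type) [AddCommGroup N] [Module A N] {n m : ℕ} (hn : 1 + n = m) :
    ExtMod A M' N n →ₗ[A] ExtMod A M'' N m :=
  h.shortExact.extClass.precompOfLinear A _ hn

/-- The connecting map in the second variable. -/
noncomputable def IsSES.extδ' {f : N' →ₗ[A] N} {g : N →ₗ[A] N''} (h : IsSES f g)
    (M : Type) [AddCommGroup M] [Module A M] {n m : ℕ} (hn : n + 1 = m) :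
    ExtMod A M N'' n →ₗ[A] ExtMod A M N' m :=
  h.shortExact.extClass.postcompOfLinear A _ hn

lemma IsSES.exact_pre {f : M' →ₗ[A] M} {g : M →ₗ[A] M''} (h : IsSES f g) (n : ℕ) :
    Function.Exact (extPre g N n) (extPre f N n) :=
  (ShortComplex.ab_exact_iff_function_exact _).mp
    (Abelian.Ext.contravariant_sequence_exact₂' h.shortExact (ModuleCat.of A N) n)

lemma IsSES.exact_pre_δ {f : M' →ₗ[A] M} {g : M →ₗ[A] M''} (h : IsSES f g) {n m : ℕ}
    (hn : 1 + n = m) : Function.Exact (extPre f N n) (h.extδ N hn) :=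
  (ShortComplex.ab_exact_iff_function_exact _).mp
    (Abelian.Ext.contravariant_sequence_exact₁' h.shortExact (ModuleCat.of A N) n m hn)

lemma IsSES.exact_δ_pre {f : M' →ₗ[A] M} {g : M →ₗ[A] M''} (h : IsSES f g) {n m : ℕ}
    (hn : 1 + n = m) : Function.Exact (h.extδ N hn) (extPre g N m) :=
  (ShortComplex.ab_exact_iff_function_exact _).mp
    (Abelian.Ext.contravariant_sequence_exact₃' h.shortExact (ModuleCat.of A N) n m hn)

lemma IsSES.exact_post {f : N' →ₗ[A] N} {g : N →ₗ[A] N''} (h : IsSES f g) (n : ℕ) :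
    Function.Exact (extPost M f n) (extPost M g n) :=
  (ShortComplex.ab_exact_iff_function_exact _).mp
    (Abelian.Ext.covariant_sequence_exact₂' (ModuleCat.of A M) h.shortExact n)

lemma IsSES.exact_post_δ {f : N' →ₗ[A] N} {g : N →ₗ[A] N''} (h : IsSES f g) {n m : ℕ}
    (hn : n + 1 = m) : Function.Exact (extPost M g n) (h.extδ' M hn) :=
  (ShortComplex.ab_exact_iff_function_exact _).mp
    (Abelian.Ext.covariant_sequence_exact₃' (ModuleCat.of A M) h.shortExact n m hn)

lemma IsSES.exact_δ_post {f : N' →ₗ[A] N} {g : N →ₗ[A] N''} (h : IsSES f g) {n m : ℕ}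
    (hn : n + 1 = m) : Function.Exact (h.extδ' M hn) (extPost M f m) :=
  (ShortComplex.ab_exact_iff_function_exact _).mp
    (Abelian.Ext.covariant_sequence_exact₁' (ModuleCat.of A M) h.shortExact n m hn)

/-- `Ext^0` is `Hom`. -/
noncomputable def extZeroEquiv (M N : Type) [AddCommGroup M] [Module A M] [AddCommGroup N]
    [Module A N] : ExtMod A M N 0 ≃ₗ[A] (M →ₗ[A] N) :=
  Abelian.Ext.linearEquiv₀ ≪≫ₗ ModuleCat.homLinearEquiv

lemma extPre_zero_apply (f : M' →ₗ[A] M) (φ : M →ₗ[A] N) :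
    extPre f N 0 ((extZeroEquiv M N).symm φ) = (extZeroEquiv M' N).symm (φ ∘ₗ f) := by
  simp only [extPre, extZeroEquiv, Abelian.Ext.linearEquiv₀]
  simp
  rfl

lemma extPost_zero_apply (g : N' →ₗ[A] N) (φ : M →ₗ[A] N') :
    extPost M g 0 ((extZeroEquiv M N').symm φ) = (extZeroEquiv M N).symm (g ∘ₗ φ) := by
  simp [extPost, extZeroEquiv, Abelian.Ext.linearEquiv₀]
  rfl

lemma extPre_comp (f : M' →ₗ[A] M) (g : M →ₗ[A] M'') (n : ℕ) :
    extPre (g ∘ₗ f) N n = extPre f N n ∘ₗ extPre g N n := by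
  refine LinearMap.ext fun x ↦ ?_
  exact (Abelian.Ext.mk₀_comp_mk₀_assoc (ModuleCat.ofHom f) (ModuleCat.ofHom g) x).symm

lemma extPost_comp (f : N' →ₗ[A] N) (g : N →ₗ[A] N'') (n : ℕ) :
    extPost M (g ∘ₗ f) n = extPost M g n ∘ₗ extPost M f n := by
  refine LinearMap.ext fun x ↦ ?_
  refine (congrArg (fun y ↦ x.comp y (add_zero n))
    (Abelian.Ext.mk₀_comp_mk₀ (ModuleCat.ofHom f) (ModuleCat.ofHom g)).symm).trans ?_
  exact (Abelian.Ext.comp_assoc_of_third_deg_zero x _ _ _).symm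

lemma extPre_lsmul (r : A) (n : ℕ) : extPre (LinearMap.lsmul A M r) N n =
    LinearMap.lsmul A _ r := by
  have : ModuleCat.ofHom (LinearMap.lsmul A M r) = r • 𝟙 (ModuleCat.of A M) := rfl
  ext x
  simp [extPre, Abelian.Ext.bilinearCompOfLinear, this, Abelian.Ext.mk₀_smul]

lemma extPost_lsmul (r : A) (n : ℕ) : extPost M (LinearMap.lsmul A N r) n =
    LinearMap.lsmul A _ r := by
  have : ModuleCat.ofHom (LinearMap.lsmul A N r) = r • 𝟙 (ModuleCat.of A N) := rfl
  ext x
  simp [extPost, Abelian.Ext.bilinearCompOfLinear, this, Abelian.Ext.mk₀_smul]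

lemma extPre_id (n : ℕ) : extPre (LinearMap.id : M →ₗ[A] M) N n = LinearMap.id := by
  have := extPre_lsmul (M := M) (N := N) (1 : A) n
  rwa [show LinearMap.lsmul A M 1 = LinearMap.id by ext; simp,
    show LinearMap.lsmul A (ExtMod A M N n) 1 = LinearMap.id by ext; simp] at this

lemma extPost_id (n : ℕ) : extPost M (LinearMap.id : N →ₗ[A] N) n = LinearMap.id := by
  have := extPost_lsmul (M := M) (N := N) (1 : A) n
  rwa [show LinearMap.lsmul A N 1 = LinearMap.id by ext; simp,
    show LinearMap.lsmul A (ExtMod A M N n) 1 = LinearMap.id by ext; simp] at this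

/-- Functoriality of `Ext` for isomorphisms. -/
noncomputable def extCongr (e : M ≃ₗ[A] M') (e' : N ≃ₗ[A] N') (n : ℕ) :
    ExtMod A M N n ≃ₗ[A] ExtMod A M' N' n :=
  LinearEquiv.ofLinearMap (extPre (N := N) e.symm.toLinearMap n) (extPre (N := N) e.toLinearMap n)
      (by rw [← extPre_comp]; simp [extPre_id]) (by rw [← extPre_comp]; simp [extPre_id]) ≪≫ₗ
    LinearEquiv.ofLinearMap (extPost M' e'.toLinearMap n) (extPost M' e'.symm.toLinearMap n)
      (by rw [← extPost_comp]; simp [extPost_id]) (by rw [← extPost_comp]; simp [extPost_id])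

end ExtSequences

section Vanishing

/-- `Ext^i_A(M, N) = 0`. -/
def EV (A : Type) [CommRing A] (i : ℕ) (M N : Type) [AddCommGroup M] [Module A M]
    [AddCommGroup N] [Module A N] : Prop :=
  Subsingleton (ExtMod A M N i)

variable {A : Type} [CommRing A]
  {M' M M'' N' N N'' : Type} [AddCommGroup M'] [Module A M'] [AddCommGroup M] [Module A M]
  [AddCommGroup M''] [Module A M''] [AddCommGroup N'] [Module A N'] [AddCommGroup N] [Module A N]
  [AddCommGroup N''] [Module A N'']

lemma subsingleton_ext1_iff (i : ℕ) : Subsingleton (ext1 A i M N) ↔ EV A i M N :=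
  (ext1LinearEquiv A M N i).toEquiv.subsingleton_congr

lemma EV.congr {i : ℕ} (h : EV A i M N) (e : M ≃ₗ[A] M') (e' : N ≃ₗ[A] N') : EV A i M' N' :=
  (extCongr e e' i).toEquiv.subsingleton_congr.mp h

lemma EV.congr_left {i : ℕ} (h : EV A i M N) (e : M ≃ₗ[A] M') : EV A i M' N :=
  h.congr e (LinearEquiv.refl A N)

lemma EV.congr_right {i : ℕ} (h : EV A i M N) (e' : N ≃ₗ[A] N') : EV A i M N' :=
  h.congr (LinearEquiv.refl A M) e'

lemma ev_zero_iff : EV A 0 M N ↔ Subsingleton (M →ₗ[A] N) :=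
  (extZeroEquiv M N).toEquiv.subsingleton_congr

lemma ev_zero_iff_forall : EV A 0 M N ↔ ∀ φ : M →ₗ[A] N, φ = 0 :=
  ev_zero_iff.trans (subsingleton_iff_forall_eq 0)

lemma EV.eq_zero {i : ℕ} (h : EV A i M N) (x : ExtMod A M N i) : x = 0 :=
  h.elim _ _

lemma ev_of_subsingleton_left [Subsingleton M] (i : ℕ) : EV A i M N :=
  subsingleton_of_forall_eq 0 fun x ↦ by
    have h : extPre LinearMap.id N i x = x := LinearMap.congr_fun (extPre_id i) x
    rw [← show extPre (LinearMap.lsmul A M 0) N i x = x by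
      conv_rhs => rw [← h]
      congr 2; exact Subsingleton.elim _ _, extPre_lsmul]
    simp

lemma ev_of_subsingleton_right [Subsingleton N] (i : ℕ) : EV A i M N :=
  subsingleton_of_forall_eq 0 fun x ↦ by
    have h : extPost M LinearMap.id i x = x := LinearMap.congr_fun (extPost_id i) x
    rw [← show extPost M (LinearMap.lsmul A N 0) i x = x by
      conv_rhs => rw [← h]
      congr 2; exact Subsingleton.elim _ _, extPost_lsmul]
    simp

lemma ev_of_projective [Module.Projective A M] (i : ℕ) : EV A (i + 1) M N :=
  have : Projective (ModuleCat.of A M) :=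
    (IsProjective.iff_projective M).mp inferInstance
  subsingleton_of_forall_eq 0 fun x ↦ x.eq_zero_of_projective

lemma IsSES.ev_mid {f : M' →ₗ[A] M} {g : M →ₗ[A] M''} (h : IsSES f g) {i : ℕ}
    (h₁ : EV A i M' N) (h₃ : EV A i M'' N) : EV A i M N :=
  subsingleton_of_forall_eq 0 fun x ↦ by
    obtain ⟨y, rfl⟩ := (h.exact_pre i x).mp (h₁.eq_zero _)
    rw [h₃.eq_zero y, map_zero]

lemma IsSES.ev_right {f : M' →ₗ[A] M} {g : M →ₗ[A] M''} (h : IsSES f g) {i : ℕ}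
    (h₁ : EV A i M' N) (h₂ : EV A (i + 1) M N) : EV A (i + 1) M'' N :=
  subsingleton_of_forall_eq 0 fun x ↦ by
    obtain ⟨y, rfl⟩ := (h.exact_δ_pre (add_comm 1 i) x).mp (h₂.eq_zero _)
    rw [h₁.eq_zero y, map_zero]

lemma IsSES.ev_left {f : M' →ₗ[A] M} {g : M →ₗ[A] M''} (h : IsSES f g) {i : ℕ}
    (h₂ : EV A i M N) (h₃ : EV A (i + 1) M'' N) : EV A i M' N :=
  subsingleton_of_forall_eq 0 fun x ↦ by
    obtain ⟨y, rfl⟩ := (h.exact_pre_δ (add_comm 1 i) x).mp (h₃.eq_zero _)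
    rw [h₂.eq_zero y, map_zero]

lemma IsSES.ev_mid' {f : N' →ₗ[A] N} {g : N →ₗ[A] N''} (h : IsSES f g) {i : ℕ}
    (h₁ : EV A i M N') (h₃ : EV A i M N'') : EV A i M N :=
  subsingleton_of_forall_eq 0 fun x ↦ by
    obtain ⟨y, rfl⟩ := (h.exact_post i x).mp (h₃.eq_zero _)
    rw [h₁.eq_zero y, map_zero]

lemma IsSES.ev_left' {f : N' →ₗ[A] N} {g : N →ₗ[A] N''} (h : IsSES f g) {i : ℕ}
    (h₃ : EV A i M N'') (h₂ : EV A (i + 1) M N) : EV A (i + 1) M N' :=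
  subsingleton_of_forall_eq 0 fun x ↦ by
    obtain ⟨y, rfl⟩ := (h.exact_δ_post rfl x).mp (h₂.eq_zero _)
    rw [h₃.eq_zero y, map_zero]

lemma IsSES.ev_right' {f : N' →ₗ[A] N} {g : N →ₗ[A] N''} (h : IsSES f g) {i : ℕ}
    (h₂ : EV A i M N) (h₁ : EV A (i + 1) M N') : EV A i M N'' :=
  subsingleton_of_forall_eq 0 fun x ↦ by
    obtain ⟨y, rfl⟩ := (h.exact_post_δ rfl x).mp (h₁.eq_zero _)
    rw [h₂.eq_zero y, map_zero]

lemma EV.zero_of_injective {f : N' →ₗ[A] N} (hf : Function.Injective f) (h : EV A 0 M N) :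
    EV A 0 M N' := by
  rw [ev_zero_iff_forall] at h ⊢
  intro φ
  rw [← LinearMap.cancel_left hf, h (f ∘ₗ φ), LinearMap.comp_zero]

lemma IsSES.exists_extend {f : M' →ₗ[A] M} {g : M →ₗ[A] M''} (h : IsSES f g)
    (h₃ : EV A 1 M'' N) (φ : M' →ₗ[A] N) : ∃ ψ : M →ₗ[A] N, ψ ∘ₗ f = φ := by
  obtain ⟨y, hy⟩ := (h.exact_pre_δ (add_zero 1) ((extZeroEquiv M' N).symm φ)).mp (h₃.eq_zero _)
  refine ⟨extZeroEquiv M N y, (extZeroEquiv M' N).symm.injective ?_⟩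
  rw [← extPre_zero_apply, LinearEquiv.symm_apply_apply, hy]

lemma IsSES.ev_one_of_exists_extend {f : M' →ₗ[A] M} {g : M →ₗ[A] M''} (h : IsSES f g)
    (h₂ : EV A 1 M N) (H : ∀ φ : M' →ₗ[A] N, ∃ ψ : M →ₗ[A] N, ψ ∘ₗ f = φ) : EV A 1 M'' N :=
  subsingleton_of_forall_eq 0 fun x ↦ by
    obtain ⟨y, rfl⟩ := (h.exact_δ_pre (add_zero 1) x).mp (h₂.eq_zero _)
    obtain ⟨ψ, hψ⟩ := H (extZeroEquiv M' N y)
    refine (h.exact_pre_δ (add_zero 1) y).mpr ⟨(extZeroEquiv M N).symm ψ, ?_⟩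
    rw [extPre_zero_apply, hψ, LinearEquiv.symm_apply_apply]

lemma IsSES.exists_lift {f : N' →ₗ[A] N} {g : N →ₗ[A] N''} (h : IsSES f g)
    (h₁ : EV A 1 M N') (φ : M →ₗ[A] N'') : ∃ ψ : M →ₗ[A] N, g ∘ₗ ψ = φ := by
  obtain ⟨y, hy⟩ := (h.exact_post_δ (zero_add 1) ((extZeroEquiv M N'').symm φ)).mp (h₁.eq_zero _)
  refine ⟨extZeroEquiv M N y, (extZeroEquiv M N'').symm.injective ?_⟩
  rw [← extPost_zero_apply, LinearEquiv.symm_apply_apply, hy]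

open scoped Pointwise in
lemma isSES_smul {r : A} (hr : IsSMulRegular M r) :
    IsSES (LinearMap.lsmul A M r) (Submodule.mkQ (r • (⊤ : Submodule A M))) := by
  refine ⟨hr, fun x ↦ ?_, Submodule.mkQ_surjective _⟩
  simp [Submodule.mem_smul_pointwise_iff_exists]

instance finite_extMod [IsNoetherianRing A] [Module.Finite A M] [Module.Finite A N] (i : ℕ) :
    Module.Finite A (ExtMod A M N i) :=
  ModuleCat.finite_ext A (ModuleCat.of A M) (ModuleCat.of A N) i

section Local

variable [IsLocalRing A]

open IsLocalRing

lemma ev_of_smul_surjective [IsNoetherianRing A] [Module.Finite A M] [Module.Finite A N] {i : ℕ}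
    {r : A}
    (hr : r ∈ maximalIdeal A) (h : ∀ x : ExtMod A M N i, ∃ y, r • y = x) : EV A i M N := by
  have : (⊤ : Submodule A (ExtMod A M N i)) ≤ maximalIdeal A • ⊤ := by
    intro x _
    obtain ⟨y, rfl⟩ := h x
    exact Submodule.smul_mem_smul hr trivial
  have h0 := Submodule.eq_bot_of_le_smul_of_le_jacobson_bot _ _ Module.Finite.fg_top this
    (maximalIdeal_le_jacobson _)
  exact (Submodule.subsingleton_iff A).mp (subsingleton_of_bot_eq_top h0.symm)

lemma EV.of_quotSMulTop_left [IsNoetherianRing A] [Module.Finite A M] [Module.Finite A N] {i : ℕ}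
    {r : A}
    (hr : r ∈ maximalIdeal A) (hreg : IsSMulRegular M r) (h : EV A (i + 1) (QuotSMulTop r M) N) :
    EV A i M N :=
  ev_of_smul_surjective hr fun x ↦ by
    obtain ⟨y, rfl⟩ := ((isSES_smul hreg).exact_pre_δ (add_comm 1 i) x).mp (h.eq_zero _)
    exact ⟨y, by rw [extPre_lsmul]; rfl⟩

end Local

end Vanishing

lemma isSMulRegular_quotient_prime {A : Type} [CommRing A] {p : PrimeSpectrum A} {x : A}
    (hxp : x ∉ p.asIdeal) :
    IsSMulRegular (A ⧸ p.asIdeal) x := by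
  rw [isSMulRegular_iff_right_eq_zero_of_smul]
  intro y hy
  obtain ⟨y, rfl⟩ := Ideal.Quotient.mk_surjective y
  rw [Algebra.smul_def, Ideal.Quotient.algebraMap_eq, ← map_mul,
    Ideal.Quotient.eq_zero_iff_mem] at hy
  exact Ideal.Quotient.eq_zero_iff_mem.mpr ((p.2.mem_or_mem hy).resolve_left hxp)

section Depth

open IsLocalRing

variable {A : Type} [CommRing A] [IsLocalRing A]
  {M N N' N'' Z K : Type} [AddCommGroup M] [Module A M] [AddCommGroup N] [Module A N]
  [AddCommGroup N'] [Module A N'] [AddCommGroup N''] [Module A N'']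
  [AddCommGroup Z] [Module A Z] [AddCommGroup K] [Module A K]

/-- `depth M ≥ n`, expressed by vanishing of `Ext^i(k, M)` for `i < n`. -/
def DepthGE (A : Type) [CommRing A] [IsLocalRing A] (n : ℕ) (M : Type) [AddCommGroup M]
    [Module A M] : Prop :=
  ∀ i < n, EV A i (ResidueField A) M

lemma le_rdepth_iff (n : ℕ) : (n : ℕ∞) ≤ rdepth A M ↔ DepthGE A n M := by
  simp only [rdepth, le_sInf_iff, Set.mem_ofPred_eq, DepthGE, subsingleton_ext1_iff]
  constructor
  · intro h i hi
    by_contra hc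
    have := h i ⟨i, rfl, hc⟩
    exact absurd (Nat.cast_le.mp this) (by omega)
  · rintro h _ ⟨m, rfl, hm⟩
    by_contra hc
    exact hm (h m (Nat.cast_lt.mp (not_le.mp hc)))

lemma DepthGE.mono {m n : ℕ} (h : DepthGE A n M) (hmn : m ≤ n) : DepthGE A m M :=
  fun i hi ↦ h i (by omega)

lemma DepthGE.congr {n : ℕ} (h : DepthGE A n N) (e : N ≃ₗ[A] N') : DepthGE A n N' :=
  fun i hi ↦ (h i hi).congr_right e

lemma depthGE_zero : DepthGE A 0 M := fun i hi ↦ absurd hi (by omega)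

lemma IsSES.depthGE_mid {f : N' →ₗ[A] N} {g : N →ₗ[A] N''} (h : IsSES f g) {n : ℕ}
    (h₁ : DepthGE A n N') (h₃ : DepthGE A n N'') : DepthGE A n N :=
  fun i hi ↦ h.ev_mid' (h₁ i hi) (h₃ i hi)

lemma IsSES.depthGE_left {f : N' →ₗ[A] N} {g : N →ₗ[A] N''} (h : IsSES f g) {n : ℕ}
    (h₂ : DepthGE A (n + 1) N) (h₃ : DepthGE A n N'') : DepthGE A (n + 1) N' := by
  intro i hi
  cases i with
  | zero => exact (h₂ 0 (by omega)).zero_of_injective h.inj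
  | succ i => exact h.ev_left' (h₃ i (by omega)) (h₂ _ hi)

lemma IsSES.depthGE_right {f : N' →ₗ[A] N} {g : N →ₗ[A] N''} (h : IsSES f g) {n : ℕ}
    (h₂ : DepthGE A n N) (h₁ : DepthGE A (n + 1) N') : DepthGE A n N'' :=
  fun i hi ↦ h.ev_right' (h₂ i hi) (h₁ (i + 1) (by omega))

lemma DepthGE.of_injective {f : N' →ₗ[A] N} (hf : Function.Injective f)
    (h : DepthGE A 1 N) : DepthGE A 1 N' := by
  intro i hi
  obtain rfl : i = 0 := by omega
  exact (h 0 hi).zero_of_injective hf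

lemma DepthGE.quotSMulTop {n : ℕ} {r : A} (hr : IsSMulRegular N r) (h : DepthGE A (n + 1) N) :
    DepthGE A n (QuotSMulTop r N) :=
  (isSES_smul hr).depthGE_right (h.mono (by omega)) h

lemma DepthGE.prod {n : ℕ} (h : DepthGE A n N) (h' : DepthGE A n N') : DepthGE A n (N × N') :=
  IsSES.depthGE_mid (f := LinearMap.inl A N N') (g := LinearMap.snd A N N')
    ⟨LinearMap.inl_injective, Function.Exact.inl_snd, LinearMap.snd_surjective⟩ h h'

instance isSimpleModule_residueField : IsSimpleModule A (ResidueField A) :=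
  isSimpleModule_iff_isCoatom.mpr (maximalIdeal.isMaximal A).out

lemma injective_of_ne_zero {φ : ResidueField A →ₗ[A] N} (hφ : φ ≠ 0) : Function.Injective φ :=
  φ.injective_or_eq_zero.resolve_right hφ

variable [IsNoetherianRing A]

lemma exists_isSMulRegular [Module.Finite A N] (h : DepthGE A 1 N) :
    ∃ x ∈ maximalIdeal A, IsSMulRegular N x := by
  have := ev_zero_iff.mp (h 0 one_pos)
  obtain ⟨r, hr, hreg⟩ := IsSMulRegular.subsingleton_linearMap_iff.mp this
  refine ⟨r, ?_, hreg⟩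
  rwa [show Module.annihilator A (ResidueField A) = maximalIdeal A from
    Ideal.annihilator_quotient] at hr

/-- Induction principle: a property of finitely generated modules holds as soon as it holds for
zero, is stable by extensions, and holds for the residue field and for the prime cyclic modules
`C` such that it holds for `C / x C` for all `x ∈ 𝔪` regular on `C`. -/
lemma ev_of_residueField_of_cyclic [Module.Finite A K] {i : ℕ}
    {P : (N : Type) → [AddCommGroup N] → [Module A N] → Prop}
    (Psub : ∀ (N N' : Type) [AddCommGroup N] [Module A N] [AddCommGroup N'] [Module A N']
      (f : N' →ₗ[A] N), Function.Injective f → P N → P N')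
    (Pquot : ∀ (N N' : Type) [AddCommGroup N] [Module A N] [AddCommGroup N'] [Module A N']
      (f : N →ₗ[A] N'), Function.Surjective f → P N → P N')
    (hk : P (ResidueField A) → EV A i (ResidueField A) K)
    (hp : ∀ (C : Type) [AddCommGroup C] [Module A C] [Module.Finite A C] (x : A),
      x ∈ maximalIdeal A → IsSMulRegular C x → P C → EV A (i + 1) (QuotSMulTop x C) K)
    [Module.Finite A N] (hN : P N) : EV A i N K := by
  refine IsNoetherianRing.induction_on_isQuotientEquivQuotientPrime A
    (motive := fun N _ _ _ ↦ P N → EV A i N K) ‹Module.Finite A N› ?_ ?_ ?_ hN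
  · intro N _ _ _ _ _
    exact ev_of_subsingleton_left i
  · intro N _ _ _ p e hN
    by_cases hpm : p.asIdeal = maximalIdeal A
    · have e' : N ≃ₗ[A] ResidueField A := e ≪≫ₗ Submodule.quotEquivOfEq _ _ hpm
      exact (hk (Pquot _ _ _ e'.surjective hN)).congr_left e'.symm
    · obtain ⟨x, hx, hxp⟩ := SetLike.exists_of_lt
        (lt_of_le_of_ne (le_maximalIdeal p.2.ne_top) hpm)
      have hreg : IsSMulRegular (A ⧸ p.asIdeal) x := isSMulRegular_quotient_prime hxp
      refine (EV.of_quotSMulTop_left hx hreg ?_).congr_left e.symm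
      exact hp _ x hx hreg (Pquot _ _ _ e.surjective hN)
  · intro N₁ _ _ _ N₂ _ _ _ N₃ _ _ _ f g hf hg hfg h₁ h₃ h₂
    exact IsSES.ev_mid ⟨hf, hfg, hg⟩ (h₁ (Psub _ _ _ hf h₂)) (h₃ (Pquot _ _ _ hg h₂))

lemma WithBot.eq_bot_or_of_add_one_le {s : WithBot ℕ∞} {r : ℕ} (h : s + 1 ≤ r) :
    s = ⊥ ∨ ∃ r', r = r' + 1 ∧ s ≤ r' := by
  induction s using WithBot.recBotCoe with
  | bot => exact .inl rfl
  | coe s =>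
    right
    have h' : s + 1 ≤ (r : ℕ∞) := by exact_mod_cast h
    cases r with
    | zero => simp at h'
    | succ r =>
      refine ⟨r, rfl, ?_⟩
      have : s ≤ (r : ℕ∞) := by
        push_cast at h'
        exact (ENat.add_le_add_iff_right (by simp)).mp h'
      exact_mod_cast this

/-- Ischebeck's theorem: `Ext^i(N, Z) = 0` for `i < depth Z - dim N`. -/
theorem ev_of_supportDim_le [Module.Finite A Z] {t : ℕ} (hZ : DepthGE A t Z) (r : ℕ) :
    ∀ (N : Type) [AddCommGroup N] [Module A N] [Module.Finite A N] (i : ℕ),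
    Module.supportDim A N ≤ r → i + r < t → EV A i N Z := by
  induction r using Nat.strong_induction_on with
  | _ r ih =>
  intro N _ _ _ i hN hi
  refine ev_of_residueField_of_cyclic (P := fun N _ _ ↦ Module.supportDim A N ≤ r)
    (fun N N' _ _ _ _ f hf h ↦ (Module.supportDim_le_of_injective f hf).trans h)
    (fun N N' _ _ _ _ f hf h ↦ (Module.supportDim_le_of_surjective f hf).trans h)
    (fun _ ↦ hZ i (by omega)) ?_ hN
  intro C _ _ _ x hx hreg hC
  rw [← Module.supportDim_quotSMulTop_succ_eq_supportDim hreg hx] at hC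
  obtain h | ⟨r', rfl, hr'⟩ := WithBot.eq_bot_or_of_add_one_le hC
  · have := (Module.supportDim_eq_bot_iff_subsingleton A _).mp h
    exact ev_of_subsingleton_left _
  · exact ih r' (by omega) _ _ hr' (by omega)

lemma not_ev_zero_of_supportDim_eq_zero [Module.Finite A N] (h : Module.supportDim A N = 0) :
    ¬ EV A 0 (ResidueField A) N := by
  intro hc
  obtain ⟨x, hx, hreg⟩ := exists_isSMulRegular (N := N) fun i hi ↦ by
    obtain rfl : i = 0 := by omega
    exact hc
  rw [← Module.supportDim_quotSMulTop_succ_eq_supportDim hreg hx] at h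
  obtain h' | ⟨r', hr, _⟩ := WithBot.eq_bot_or_of_add_one_le (r := 0) h.le
  · simp [h'] at h
  · omega

lemma exists_finite_projectiveDimension {d : ℕ} (hdim : ringKrullDim A = d)
    (hdep : DepthGE A d A) : ∀ j ≤ d, ∃ Q : ModuleCat.{0} A, Module.Finite A Q ∧
      DepthGE A (d - j) Q ∧ Module.supportDim A Q + j = d ∧
      ∀ (K : Type) [AddCommGroup K] [Module A K], ∀ i > j, EV A i Q K := by
  intro j hj
  induction j with
  | zero =>
    refine ⟨ModuleCat.of A A, inferInstanceAs (Module.Finite A A), hdep, ?_, ?_⟩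
    · simpa [Module.supportDim_self_eq_ringKrullDim] using hdim
    · intro K _ _ i hi
      obtain ⟨i, rfl⟩ : ∃ i', i = i' + 1 := ⟨i - 1, by omega⟩
      exact ev_of_projective (M := A) i
  | succ j ih =>
    obtain ⟨Q, _, hQ, hs, hpd⟩ := ih (by omega)
    obtain ⟨x, hx, hreg⟩ := exists_isSMulRegular (hQ.mono (by omega : 1 ≤ d - j))
    refine ⟨ModuleCat.of A (QuotSMulTop x Q), inferInstanceAs (Module.Finite A (QuotSMulTop x Q)),
      ?_, ?_, ?_⟩
    · exact DepthGE.quotSMulTop hreg (by rwa [show d - (j + 1) + 1 = d - j by omega])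
    · rw [← hs, ← Module.supportDim_quotSMulTop_succ_eq_supportDim hreg hx, add_assoc]
      push_cast
      rw [add_comm (1 : WithBot ℕ∞)]
    · intro K _ _ i hi
      obtain ⟨i, rfl⟩ : ∃ i', i = i' + 1 := ⟨i - 1, by omega⟩
      exact (isSES_smul hreg).ev_right (hpd K i (by omega)) (hpd K (i + 1) (by omega))

/-- If `Ext^m(-, K)` vanishes on finitely generated modules for large `m` then it does so
for `m > dim A`. -/
lemma ev_of_gt_dim {d : ℕ} (hdim : ringKrullDim A = d) (hdep : DepthGE A d A)
    [Module.Finite A K] {b : ℕ} (hb : ∀ (N : Type) [AddCommGroup N] [Module A N]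
      [Module.Finite A N], ∀ m > b, EV A m N K) (j : ℕ) :
    ∀ (N : Type) [AddCommGroup N] [Module A N] [Module.Finite A N], ∀ m > d, b < m + j →
      EV A m N K := by
  induction j with
  | zero => exact fun N _ _ _ m _ h ↦ hb N m h
  | succ j ih =>
    intro N _ _ _ m hm hmj
    refine ev_of_residueField_of_cyclic (P := fun _ _ _ ↦ True) (fun _ _ _ _ _ _ _ _ h ↦ h)
      (fun _ _ _ _ _ _ _ _ h ↦ h) (fun _ ↦ ?_)
      (fun C _ _ _ x hx hreg _ ↦ ih _ (m + 1) (by omega) (by omega)) trivial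
    obtain ⟨Q, _, -, hs, hpd⟩ := exists_finite_projectiveDimension hdim hdep d le_rfl
    have hs' : Module.supportDim A Q = 0 := by
      induction h : Module.supportDim A Q using WithBot.recBotCoe with
      | bot => simp [h] at hs
      | coe s =>
        rw [h] at hs
        have hs1 : s + (d : ℕ∞) ≤ 0 + d := by rw [zero_add]; exact_mod_cast hs.le
        have := nonpos_iff_eq_zero.mp ((ENat.add_le_add_iff_right (by simp)).mp hs1)
        simp [this]
    have hne := not_ev_zero_of_supportDim_eq_zero hs'
    rw [ev_zero_iff_forall] at hne
    push Not at hne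
    obtain ⟨φ, hφ⟩ := hne
    exact (isSES_range (injective_of_ne_zero hφ)).ev_left (hpd K m hm)
      (ih _ (m + 1) (by omega) (by omega))

/-- `Ext^m(N, K) = 0` for `m > dim A - depth N` if `K` has finite injective dimension. -/
lemma ev_of_depthGE {d : ℕ} (hdim : ringKrullDim A = d) (hdep : DepthGE A d A)
    [Module.Finite A K] {b : ℕ} (hb : ∀ (N : Type) [AddCommGroup N] [Module A N]
      [Module.Finite A N], ∀ m > b, EV A m N K) (t : ℕ) :
    ∀ (N : Type) [AddCommGroup N] [Module A N] [Module.Finite A N], DepthGE A t N →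
      ∀ m, d < m + t → EV A m N K := by
  induction t with
  | zero => exact fun N _ _ _ _ m hm ↦ ev_of_gt_dim hdim hdep hb b N m (by omega) (by omega)
  | succ t ih =>
    intro N _ _ _ hN m hm
    obtain ⟨x, hx, hreg⟩ := exists_isSMulRegular (hN.mono (by omega : 1 ≤ t + 1))
    exact .of_quotSMulTop_left hx hreg (ih _ (hN.quotSMulTop hreg) _ (by omega))

end Depth

section Endomorphisms

open IsLocalRing
open scoped Pointwise

variable {A : Type} [CommRing A]
  {M N V K : Type} [AddCommGroup M] [Module A M] [AddCommGroup N] [Module A N]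
  [AddCommGroup V] [Module A V] [AddCommGroup K] [Module A K]

lemma length_ne_top_of_isFiniteLength (h : IsFiniteLength A M) : Module.length A M ≠ ⊤ :=
  Module.length_ne_top_iff.mpr h

lemma injective_of_surjective_of_length_eq {f : M →ₗ[A] N} (hf : Function.Surjective f)
    (hM : IsFiniteLength A M) (h : Module.length A M = Module.length A N) :
    Function.Injective f := by
  have h1 := Module.length_eq_add_of_exact (LinearMap.ker f).subtype f Subtype.val_injective hf
    f.exact_subtype_ker_map
  have h2 : Module.length A N ≠ ⊤ := h ▸ length_ne_top_of_isFiniteLength hM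
  rw [h] at h1
  have h3 : Module.length A (LinearMap.ker f) = 0 := by
    have : Module.length A (LinearMap.ker f) + Module.length A N ≤ 0 + Module.length A N := by
      rw [← h1, zero_add]
    exact nonpos_iff_eq_zero.mp ((ENat.add_le_add_iff_right h2).mp this)
  rw [Module.length_eq_zero_iff] at h3
  exact LinearMap.ker_eq_bot.mp ((Submodule.subsingleton_iff_eq_bot).mp h3)

lemma surjective_of_injective_of_length_eq {f : M →ₗ[A] N} (hf : Function.Injective f)
    (hM : IsFiniteLength A M) (h : Module.length A M = Module.length A N) :
    Function.Surjective f := by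
  have h1 := Module.length_eq_add_of_exact f (LinearMap.range f).mkQ hf
    (Submodule.mkQ_surjective _) f.exact_map_mkQ_range
  have h2 : Module.length A M ≠ ⊤ := length_ne_top_of_isFiniteLength hM
  rw [← h] at h1
  have h3 : Module.length A (N ⧸ LinearMap.range f) = 0 := by
    have : Module.length A M + Module.length A (N ⧸ LinearMap.range f) ≤ Module.length A M + 0 := by
      rw [← h1, add_zero]
    exact nonpos_iff_eq_zero.mp ((ENat.add_le_add_iff_left h2).mp this)
  rw [Module.length_eq_zero_iff] at h3
  exact LinearMap.range_eq_top.mp (Submodule.Quotient.subsingleton_iff.mp h3)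

/-- `Hom(A/I, N) = N` if `I N = 0`. -/
noncomputable def homQuotEquiv (I : Ideal A) (hI : I ≤ Module.annihilator A N) :
    ((A ⧸ I) →ₗ[A] N) ≃ₗ[A] N :=
  LinearEquiv.ofBijective (LinearMap.applyₗ (1 : A ⧸ I)) (by
    constructor
    · intro φ ψ h
      refine Submodule.linearMap_qext _ (LinearMap.ext_ring ?_)
      exact h
    · intro n
      have hle : I ≤ LinearMap.ker (LinearMap.toSpanSingleton A N n) := fun r hr ↦ by
        simpa using Module.mem_annihilator.mp (hI hr) n
      exact ⟨Submodule.liftQ I (LinearMap.toSpanSingleton A N n) hle, one_smul A n⟩)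

lemma IsSES.extPre_injective {M' M'' : Type} [AddCommGroup M'] [Module A M'] [AddCommGroup M'']
    [Module A M''] {f : M' →ₗ[A] M} {g : M →ₗ[A] M''} (h : IsSES f g) {n : ℕ}
    (H : ∀ i < n, EV A i M' N) : Function.Injective (extPre g N n) := by
  rw [injective_iff_map_eq_zero]
  intro x hx
  cases n with
  | zero =>
    obtain ⟨φ, rfl⟩ := (extZeroEquiv M'' N).symm.surjective x
    rw [extPre_zero_apply, LinearEquiv.map_eq_zero_iff] at hx
    rw [LinearEquiv.map_eq_zero_iff, ← LinearMap.cancel_right h.surj, hx, LinearMap.zero_comp]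
  | succ n =>
    obtain ⟨y, rfl⟩ := (h.exact_δ_pre (add_comm 1 n) x).mp hx
    rw [(H n (by omega)).eq_zero y, map_zero]

lemma IsSES.extPre_surjective {M' M'' : Type} [AddCommGroup M'] [Module A M'] [AddCommGroup M'']
    [Module A M''] {f : M' →ₗ[A] M} {g : M →ₗ[A] M''} (h : IsSES f g) {n : ℕ}
    (H : EV A (n + 1) M'' N) : Function.Surjective (extPre f N n) :=
  fun x ↦ (h.exact_pre_δ (add_comm 1 n) x).mp (H.eq_zero _)

variable [IsLocalRing A]

lemma nonempty_equiv_residueField [IsSimpleModule A M] : Nonempty (M ≃ₗ[A] ResidueField A) := by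
  obtain ⟨I, hI, ⟨e⟩⟩ := isSimpleModule_iff_quot_maximal.mp ‹IsSimpleModule A M›
  exact ⟨e ≪≫ₗ Submodule.quotEquivOfEq _ _ (eq_maximalIdeal hI)⟩

lemma ev_of_isFiniteLength {i : ℕ} (h : EV A i (ResidueField A) K) (hV : IsFiniteLength A V) :
    EV A i V K := by
  induction hV with
  | of_subsingleton => exact ev_of_subsingleton_left i
  | of_simple_quotient _ ih =>
    rename_i P _ _ Q _ _
    obtain ⟨e⟩ := nonempty_equiv_residueField (A := A) (M := P ⧸ Q)
    exact (isSES_mkQ Q).ev_mid ih (h.congr_left e.symm)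

lemma length_extMod {d : ℕ} (hK : DepthGE A d K) (h1 : EV A (d + 1) (ResidueField A) K)
    (e : ExtMod A (ResidueField A) K d ≃ₗ[A] ResidueField A) (hV : IsFiniteLength A V) :
    Module.length A (ExtMod A V K d) = Module.length A V := by
  induction hV with
  | of_subsingleton =>
    rename_i P _ _ _
    have : Subsingleton (ExtMod A P K d) := ev_of_subsingleton_left d
    rw [Module.length_eq_zero, Module.length_eq_zero]
  | of_simple_quotient hQ ih =>
    rename_i P _ _ Q _
    obtain ⟨e'⟩ := nonempty_equiv_residueField (A := A) (M := P ⧸ Q)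
    have hs := isSES_mkQ Q
    rw [Module.length_eq_add_of_exact _ _
      (hs.extPre_injective fun i hi ↦ ev_of_isFiniteLength (hK i hi) hQ)
      (hs.extPre_surjective (h1.congr_left e'.symm)) (hs.exact_pre d), ih,
      Module.length_eq_add_of_exact _ _ hs.inj hs.surj hs.exact, add_comm]
    congr 1
    exact ((extCongr e' (LinearEquiv.refl A K) d) ≪≫ₗ e ≪≫ₗ e'.symm).length_eq

variable [IsNoetherianRing A]

lemma isFiniteLength_of_supportDim_le_zero [Module.Finite A N]
    (h : Module.supportDim A N ≤ 0) : IsFiniteLength A N := by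
  refine IsNoetherianRing.induction_on_isQuotientEquivQuotientPrime A
    (motive := fun N _ _ _ ↦ Module.supportDim A N ≤ 0 → IsFiniteLength A N) ‹_› ?_ ?_ ?_ h
  · intro N _ _ _ _ _
    exact .of_subsingleton
  · intro N _ _ _ p e hN
    by_cases hpm : p.asIdeal = maximalIdeal A
    · have e' : N ≃ₗ[A] ResidueField A := e ≪≫ₗ Submodule.quotEquivOfEq _ _ hpm
      have := IsSimpleModule.congr e'
      exact isFiniteLength_iff_isNoetherian_isArtinian.mpr ⟨inferInstance, inferInstance⟩
    · obtain ⟨x, hx, hxp⟩ := SetLike.exists_of_lt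
        (lt_of_le_of_ne (le_maximalIdeal p.2.ne_top) hpm)
      have hreg : IsSMulRegular (A ⧸ p.asIdeal) x := isSMulRegular_quotient_prime hxp
      rw [Module.supportDim_eq_of_equiv e,
        ← Module.supportDim_quotSMulTop_succ_eq_supportDim hreg hx] at hN
      obtain h' | ⟨r', hr, _⟩ := WithBot.eq_bot_or_of_add_one_le (r := 0) hN
      · have h0 : Module.supportDim A (A ⧸ p.asIdeal) = ⊥ := by
          rw [← Module.supportDim_quotSMulTop_succ_eq_supportDim hreg hx, h', WithBot.bot_add]
        rw [← Module.supportDim_eq_of_equiv e, Module.supportDim_eq_bot_iff_subsingleton] at h0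
        exact .of_subsingleton
      · omega
  · intro N₁ _ _ _ N₂ _ _ _ N₃ _ _ _ f g hf hg hfg h₁ h₃ h₂
    have h1 := h₁ ((Module.supportDim_le_of_injective f hf).trans h₂)
    have h3 := h₃ ((Module.supportDim_le_of_surjective g hg).trans h₂)
    rw [← Module.length_ne_top_iff] at h1 h3 ⊢
    rw [Module.length_eq_add_of_exact f g hf hg hfg]
    exact WithTop.add_ne_top.mpr ⟨h1, h3⟩

lemma exists_smul_of_length_extMod (t : ℕ) : ∀ (N C : Type) [AddCommGroup N] [Module A N]
    [Module.Finite A N] [AddCommGroup C] [Module A C] (c : C) (_ : A ∙ c = ⊤)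
    (_ : Module.annihilator A C ≤ Module.annihilator A N) (_ : DepthGE A t N)
    (_ : DepthGE A t C) (_ : Module.supportDim A C ≤ t)
    (_ : ∀ (V : Type) [AddCommGroup V] [Module A V], IsFiniteLength A V →
      Module.annihilator A C ≤ Module.annihilator A V →
      Module.length A (ExtMod A V N t) = Module.length A V),
    (∀ φ : N →ₗ[A] N, ∃ r : A, LinearMap.lsmul A N r = φ) ∧
      Module.annihilator A N ≤ Module.annihilator A C := by
  induction t with
  | zero =>
    intro N C _ _ _ _ _ c hc hann hN hC hdim H
    have hCfin : Module.Finite A C := ⟨⟨{c}, by simpa using hc⟩⟩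
    have hdimA : Module.supportDim A (A ⧸ Module.annihilator A C) ≤ 0 := by
      rw [Module.supportDim_quotient_eq_ringKrullDim,
        ← Module.supportDim_eq_ringKrullDim_quotient_annihilator]
      exact hdim
    have hl (I : Ideal A) (hI : Module.annihilator A C ≤ I) : IsFiniteLength A (A ⧸ I) :=
      isFiniteLength_of_supportDim_le_zero
        ((Module.supportDim_le_of_surjective (Submodule.factor hI)
          (Submodule.factor_surjective hI)).trans hdimA)
    have hlen (I : Ideal A) (hI : Module.annihilator A C ≤ I)
        (hI' : I ≤ Module.annihilator A N) :
        Module.length A (A ⧸ I) = Module.length A N := by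
      rw [← H _ (hl I hI) (by rwa [Ideal.annihilator_quotient])]
      exact ((extZeroEquiv _ _) ≪≫ₗ homQuotEquiv I hI').length_eq
    have h1 := hlen _ le_rfl hann
    have h2 := hlen _ hann le_rfl
    have hNl : IsFiniteLength A N := by
      rw [← Module.length_ne_top_iff, ← h1, Module.length_ne_top_iff]
      exact hl _ le_rfl
    have h3 := H N hNl hann
    constructor
    · let f : (A ⧸ Module.annihilator A N) →ₗ[A] (N →ₗ[A] N) :=
        Submodule.liftQ _ (LinearMap.lsmul A N) fun r hr ↦
          LinearMap.ext fun n ↦ Module.mem_annihilator.mp hr n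
      have hf : Function.Injective f := by
        rw [← LinearMap.ker_eq_bot]
        refine Submodule.ker_liftQ_eq_bot _ _ _ fun r hr ↦ ?_
        rw [Module.mem_annihilator]
        exact fun n ↦ LinearMap.congr_fun hr n
      intro φ
      obtain ⟨q, hq⟩ := surjective_of_injective_of_length_eq hf (hl _ hann)
        (h2.trans (h3.symm.trans (extZeroEquiv N N).length_eq)) φ
      obtain ⟨r, rfl⟩ := Submodule.mkQ_surjective _ q
      exact ⟨r, hq⟩
    · have hinj := injective_of_surjective_of_length_eq (Submodule.factor_surjective hann)
        (hl _ le_rfl) (h1.trans h2.symm)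
      intro r hr
      have : Submodule.factor hann (Submodule.Quotient.mk r) = 0 :=
        (Submodule.Quotient.mk_eq_zero _).mpr hr
      exact (Submodule.Quotient.mk_eq_zero _).mp (hinj (this.trans (map_zero _).symm))
  | succ t ih =>
    intro N C _ _ _ _ _ c hc hann hN hC hdim H
    have hCfin : Module.Finite A C := ⟨⟨{c}, by simpa using hc⟩⟩
    obtain ⟨x, hx, hxreg⟩ := exists_isSMulRegular ((hN.prod hC).mono (by omega : 1 ≤ t + 1))
    have hxN : IsSMulRegular N x := fun a b h ↦ by
      simpa using @hxreg (a, 0) (b, 0) (Prod.ext h rfl)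
    have hxC : IsSMulRegular C x := fun a b h ↦ by
      simpa using @hxreg (0, a) (0, b) (Prod.ext rfl h)
    have hsub (r : A) (hr : r ∈ Module.annihilator A (QuotSMulTop x C)) :
        ∃ s : A, r - x * s ∈ Module.annihilator A C := by
      have h0 : (Submodule.Quotient.mk (r • c) : QuotSMulTop x C) = 0 :=
        Module.mem_annihilator.mp hr (Submodule.Quotient.mk c)
      rw [Submodule.Quotient.mk_eq_zero, Submodule.mem_smul_pointwise_iff_exists] at h0
      obtain ⟨c', -, hc'⟩ := h0
      obtain ⟨s, rfl⟩ := Submodule.mem_span_singleton.mp (hc ▸ Submodule.mem_top : c' ∈ A ∙ c)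
      refine ⟨s, Module.mem_annihilator.mpr fun y ↦ ?_⟩
      obtain ⟨u, rfl⟩ := Submodule.mem_span_singleton.mp (hc ▸ Submodule.mem_top : y ∈ A ∙ c)
      rw [smul_comm, sub_smul, mul_smul, hc', sub_self, smul_zero]
    have hxq (P : Type) [AddCommGroup P] [Module A P] :
        x ∈ Module.annihilator A (QuotSMulTop x P) := by
      rw [Module.mem_annihilator]
      intro p
      obtain ⟨p, rfl⟩ := Submodule.mkQ_surjective _ p
      rw [← map_smul]
      exact (Submodule.Quotient.mk_eq_zero _).mpr
        (Submodule.smul_mem_pointwise_smul _ _ _ trivial)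
    have hannq (P : Type) [AddCommGroup P] [Module A P] :
        Module.annihilator A P ≤ Module.annihilator A (QuotSMulTop x P) :=
      LinearMap.annihilator_le_of_surjective _ (Submodule.mkQ_surjective _)
    obtain ⟨hE, hA⟩ := ih (QuotSMulTop x N) (QuotSMulTop x C) (Submodule.Quotient.mk c) (by
        have := congrArg (Submodule.map (Submodule.mkQ (x • (⊤ : Submodule A C)))) hc
        rw [Submodule.map_span, Set.image_singleton, Submodule.map_top, Submodule.range_mkQ] at this
        exact this)
      (by
        intro r hr
        obtain ⟨s, hs⟩ := hsub r hr
        have := add_mem (hannq N (hann hs)) (Ideal.mul_mem_right s _ (hxq N))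
        rwa [sub_add_cancel] at this)
      (hN.quotSMulTop hxN) (hC.quotSMulTop hxC)
      (by
        rw [← Module.supportDim_quotSMulTop_succ_eq_supportDim hxC hx] at hdim
        obtain h | ⟨r', hr, h⟩ := WithBot.eq_bot_or_of_add_one_le hdim
        · rw [h]; exact bot_le
        · obtain rfl : t = r' := by omega
          exact h)
      (by
        intro V _ _ hV hVC
        rw [← H V hV ((hannq C).trans hVC)]
        have hs := isSES_smul hxN
        have hb : Function.Bijective (hs.extδ' V (rfl : t + 1 = t + 1)) := by
          constructor
          · rw [injective_iff_map_eq_zero]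
            intro y hy
            obtain ⟨z, rfl⟩ := (hs.exact_post_δ rfl y).mp hy
            rw [(ev_of_isFiniteLength (hN t (by omega)) hV).eq_zero z, map_zero]
          · intro y
            refine (hs.exact_δ_post rfl y).mp ?_
            rw [extPost_lsmul, ← extPre_lsmul, show LinearMap.lsmul A V x =
              LinearMap.lsmul A V 0 from LinearMap.ext fun v ↦ by
                simpa using Module.mem_annihilator.mp (hVC (hxq C)) v, extPre_lsmul]
            simp
        exact (LinearEquiv.ofBijective _ hb).length_eq)
    constructor
    · have key : (⊤ : Submodule A (N →ₗ[A] N)) ≤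
          LinearMap.range (LinearMap.lsmul A N) := by
        refine Submodule.le_of_le_smul_of_le_jacobson_bot Module.Finite.fg_top
          (maximalIdeal_le_jacobson (⊥ : Ideal A)) fun φ _ ↦ ?_
        obtain ⟨r, hr⟩ := hE ((QuotSMulTop.map x) φ)
        have h1 (n : N) : ∃ n', x • n' = φ n - r • n := by
          have := LinearMap.congr_fun hr (Submodule.Quotient.mk n)
          have h0 : (Submodule.Quotient.mk (r • n) : QuotSMulTop x N) =
            Submodule.Quotient.mk (φ n) := this
          have h0 := (Submodule.Quotient.eq _).mp h0.symm
          rw [Submodule.mem_smul_pointwise_iff_exists] at h0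
          obtain ⟨n', -, h⟩ := h0
          exact ⟨n', h⟩
        choose ψ hψ using h1
        let ψ' : N →ₗ[A] N :=
          { toFun := ψ
            map_add' := fun a b ↦ hxN (by
              simp only [smul_add, hψ, map_add]
              abel)
            map_smul' := fun s a ↦ hxN (by
              simp only [RingHom.id_apply, smul_comm x s, hψ, map_smul, smul_sub, smul_comm r s]) }
        rw [Submodule.mem_sup]
        refine ⟨LinearMap.lsmul A N r, ⟨r, rfl⟩, x • ψ', Submodule.smul_mem_smul hx trivial, ?_⟩
        ext n
        change r • n + x • ψ n = φ n
        rw [hψ]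
        abel
      intro φ
      exact key (x := φ) trivial
    · refine Submodule.le_of_le_smul_of_le_jacobson_bot (IsNoetherian.noetherian _)
        (maximalIdeal_le_jacobson (⊥ : Ideal A)) fun r hr ↦ ?_
      obtain ⟨s, hs⟩ := hsub r (hA (hannq N hr))
      have hsN : s ∈ Module.annihilator A N := by
        rw [Module.mem_annihilator]
        intro n
        refine isSMulRegular_iff_right_eq_zero_of_smul.mp hxN _ ?_
        have := Module.mem_annihilator.mp (sub_mem hr (hann hs)) n
        rwa [sub_sub_cancel, mul_smul] at this
      rw [Submodule.mem_sup]
      exact ⟨_, hs, x * s, Submodule.smul_mem_smul hx hsN, by ring⟩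

/-- Every endomorphism of a canonical module is a homothety. -/
lemma exists_smul_eq_of_canonical {d : ℕ} (hdim : ringKrullDim A = d) (hdep : DepthGE A d A)
    [Module.Finite A K] (hK : DepthGE A d K) (h1 : EV A (d + 1) (ResidueField A) K)
    (e : ExtMod A (ResidueField A) K d ≃ₗ[A] ResidueField A) :
    (∀ φ : K →ₗ[A] K, ∃ r : A, LinearMap.lsmul A K r = φ) ∧ Module.annihilator A K = ⊥ := by
  have hA : Module.annihilator A A = ⊥ := by
    rw [eq_bot_iff]
    intro r hr
    simpa using Module.mem_annihilator.mp hr (1 : A)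
  have := exists_smul_of_length_extMod d K A 1 (by
    rw [← Ideal.span, Ideal.span_singleton_one]) (by rw [hA]; exact bot_le) hK hdep
    (by rw [Module.supportDim_self_eq_ringKrullDim, hdim])
    fun V _ _ hV _ ↦ length_extMod hK h1 e hV
  exact ⟨this.1, by rw [eq_bot_iff, ← hA]; exact this.2⟩

end Endomorphisms

section Duality

open IsLocalRing

variable {A : Type} [CommRing A]
  {M N L F K N' N'' : Type} [AddCommGroup M] [Module A M] [AddCommGroup N] [Module A N]
  [AddCommGroup L] [Module A L] [AddCommGroup F] [Module A F] [AddCommGroup K] [Module A K]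
  [AddCommGroup N'] [Module A N'] [AddCommGroup N''] [Module A N'']

@[simp]
lemma deltaMap_apply (n : N) (φ : N →ₗ[A] K) : deltaMap A K N n φ = φ n := rfl

@[simp]
lemma dmap_apply (f : M →ₗ[A] N) (φ : N →ₗ[A] K) : dmap A K f φ = φ ∘ₗ f := rfl

lemma mem_ker_deltaMap {n : N} : n ∈ LinearMap.ker (deltaMap A K N) ↔ ∀ φ : N →ₗ[A] K, φ n = 0 :=
  ⟨fun h φ ↦ LinearMap.congr_fun h φ, fun h ↦ LinearMap.ext h⟩

lemma exists_comp_eq {f : M →ₗ[A] N} {g : N →ₗ[A] L} (hfg : Function.Exact f g)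
    (hg : Function.Surjective g) {φ : N →ₗ[A] K} (hφ : φ ∘ₗ f = 0) :
    ∃ ψ : L →ₗ[A] K, ψ ∘ₗ g = φ := by
  refine ⟨(LinearMap.ker g).liftQ φ (fun x hx ↦ ?_) ∘ₗ
    (g.quotKerEquivOfSurjective hg).symm.toLinearMap, LinearMap.ext fun x ↦ ?_⟩
  · obtain ⟨y, rfl⟩ := (hfg x).mp hx
    exact LinearMap.congr_fun hφ y
  · have : (g.quotKerEquivOfSurjective hg).symm (g x) = (LinearMap.ker g).mkQ x := by
      rw [LinearEquiv.symm_apply_eq]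
      rfl
    simp [this]

lemma dmap_injective {g : N →ₗ[A] L} (hg : Function.Surjective g) :
    Function.Injective (dmap A K g) :=
  fun _ _ h ↦ (LinearMap.cancel_right hg).mp h

lemma exact_dmap {f : M →ₗ[A] N} {g : N →ₗ[A] L} (hfg : Function.Exact f g)
    (hg : Function.Surjective g) : Function.Exact (dmap A K g) (dmap A K f) := by
  refine fun φ ↦ ⟨fun h ↦ exists_comp_eq hfg hg h, ?_⟩
  rintro ⟨ψ, rfl⟩
  ext x
  simp [hfg.apply_apply_eq_zero]

lemma IsSES.dual {f : N' →ₗ[A] N} {g : N →ₗ[A] N''} (h : IsSES f g) (h₁ : EV A 1 N'' K) :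
    IsSES (dmap A K g) (dmap A K f) :=
  ⟨dmap_injective h.surj, exact_dmap h.exact h.surj, h.exists_extend h₁⟩

/-- The dual of a finite free module is a power of `K`. -/
noncomputable def dualFinEquiv (A K : Type) [CommRing A] [AddCommGroup K] [Module A K] (n : ℕ) :
    ((Fin n → A) →ₗ[A] K) ≃ₗ[A] (Fin n → K) :=
  ((Pi.basisFun A (Fin n)).constr A).symm

lemma ev_pi {n : ℕ} {i : ℕ} (h : EV A i M K) : EV A i M (Fin n → K) := by
  induction n with
  | zero => exact ev_of_subsingleton_right i
  | succ n ih =>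
    refine EV.congr_right (N := K × (Fin n → K)) ?_ (Fin.consLinearEquiv A fun _ ↦ K)
    exact IsSES.ev_mid' (f := LinearMap.inl A K (Fin n → K)) (g := LinearMap.snd A K (Fin n → K))
      ⟨LinearMap.inl_injective, Function.Exact.inl_snd, LinearMap.snd_surjective⟩ h ih

lemma deltaMap_pi_bijective (hend : ∀ φ : K →ₗ[A] K, ∃ r : A, LinearMap.lsmul A K r = φ)
    (hann : Module.annihilator A K = ⊥) (n : ℕ) :
    Function.Bijective (deltaMap A K (Fin n → A)) := by
  constructor
  · rw [← LinearMap.ker_eq_bot, eq_bot_iff]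
    intro x hx
    rw [mem_ker_deltaMap] at hx
    refine (Submodule.mem_bot A).mpr (funext fun i ↦ ?_)
    have : x i ∈ Module.annihilator A K :=
      Module.mem_annihilator.mpr fun k ↦ hx ((LinearMap.proj i : (Fin n → A) →ₗ[A] A).smulRight k)
    rwa [hann] at this
  · intro φ
    have h (i : Fin n) := hend
      { toFun := fun k ↦ φ ((LinearMap.proj i : (Fin n → A) →ₗ[A] A).smulRight k)
        map_add' := fun a b ↦ by
          rw [← map_add]
          congr 1
          ext
          simp
        map_smul' := fun a b ↦ by
          rw [RingHom.id_apply, ← map_smul]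
          exact congrArg φ (LinearMap.ext fun x ↦ smul_comm (x i) a b) }
    choose r hr using h
    refine ⟨r, LinearMap.ext fun f ↦ ?_⟩
    have hf : f = ∑ i, (LinearMap.proj i : (Fin n → A) →ₗ[A] A).smulRight
        (f (Pi.single i 1)) := by
      refine LinearMap.pi_ext' fun i ↦ LinearMap.ext_ring ?_
      simp [Pi.single_apply]
    conv_rhs => rw [hf, map_sum]
    have h2 (i : Fin n) (k : K) :
        φ ((LinearMap.proj i : (Fin n → A) →ₗ[A] A).smulRight k) = r i • k :=
      (LinearMap.congr_fun (hr i) k).symm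
    simp only [h2]
    rw [deltaMap_apply]
    conv_lhs => rw [hf]
    simp [LinearMap.sum_apply]

/-- A module that behaves like a canonical module over a `d`-dimensional Cohen–Macaulay
local ring; unlike the definition through the type, these properties localize readily. -/
structure Canonical (A : Type) [CommRing A] [IsLocalRing A] (d : ℕ) (K : Type) [AddCommGroup K]
    [Module A K] : Prop where
  dim_eq : ringKrullDim A = d
  depth_ring : DepthGE A d A
  finite : Module.Finite A K
  depth : DepthGE A d K
  fid : ∃ b : ℕ, ∀ (N : Type) [AddCommGroup N] [Module A N] [Module.Finite A N], ∀ m > b,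
    EV A m N K
  end_eq : ∀ φ : K →ₗ[A] K, ∃ r : A, LinearMap.lsmul A K r = φ
  faithful : Module.annihilator A K = ⊥

namespace Canonical

variable [IsLocalRing A] {d : ℕ}

lemma depthGE_dual_pi (hK : Canonical A d K) (n : ℕ) : DepthGE A d ((Fin n → A) →ₗ[A] K) :=
  DepthGE.congr (fun i hi ↦ ev_pi (hK.depth i hi)) (dualFinEquiv A K n).symm

lemma deltaMap_pi_bijective (hK : Canonical A d K) (n : ℕ) : Function.Bijective
    (deltaMap A K (Fin n → A)) :=
  _root_.deltaMap_pi_bijective hK.end_eq hK.faithful n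

variable [IsNoetherianRing A]

lemma ev_of_depthGE (hK : Canonical A d K) [Module.Finite A N] {t m : ℕ} (hN : DepthGE A t N)
    (hm : d < m + t) :
    EV A m N K := by
  obtain ⟨b, hb⟩ := hK.fid
  have := hK.finite
  exact _root_.ev_of_depthGE hK.dim_eq hK.depth_ring hb t N hN m hm

lemma ev_of_lt (hK : Canonical A d K) [Module.Finite A N] {m : ℕ} (hm : d < m) : EV A m N K :=
  hK.ev_of_depthGE depthGE_zero (by omega : d < m + 0)

lemma finite_dual (hK : Canonical A d K) [Module.Finite A N] : Module.Finite A (N →ₗ[A] K) :=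
  have := hK.finite
  inferInstance

lemma depthGE_dual_of_ev (hK : Canonical A d K) (t : ℕ) : ∀ (N : Type) [AddCommGroup N] [Module A N]
    [Module.Finite A N], (∀ i, EV A (i + 1) N K) → t ≤ d → DepthGE A t (N →ₗ[A] K) := by
  induction t with
  | zero => exact fun _ _ _ _ _ _ ↦ depthGE_zero
  | succ t ih =>
    intro N _ _ _ hN ht
    obtain ⟨n, π, hπ⟩ := Module.Finite.exists_fin' A N
    have hs := isSES_ker hπ
    exact (hs.dual (hN 0)).depthGE_left ((hK.depthGE_dual_pi n).mono ht)
      (ih _ (fun i ↦ hs.ev_left (ev_of_projective i) (hN (i + 1))) (by omega))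

lemma deltaMap_surjective_of_ev (hK : Canonical A d K) [Module.Finite A N]
    (hN : ∀ i, EV A (i + 1) N K) :
    Function.Surjective (deltaMap A K N) := by
  obtain ⟨n, π, hπ⟩ := Module.Finite.exists_fin' A N
  have hs := isSES_ker hπ
  have := hK.finite_dual (N := LinearMap.ker π)
  have hL := hK.depthGE_dual_of_ev d (LinearMap.ker π)
    (fun i ↦ hs.ev_left (ev_of_projective i) (hN (i + 1))) le_rfl
  have hd := (hs.dual (hN 0)).dual (hK.ev_of_depthGE hL (by omega : d < 1 + d))
  intro φ
  obtain ⟨ψ, rfl⟩ := hd.surj φ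
  obtain ⟨x, rfl⟩ := (hK.deltaMap_pi_bijective n).2 ψ
  exact ⟨π x, rfl⟩

lemma deltaMap_bijective_of_ev (hK : Canonical A d K) [Module.Finite A N]
    (hN : ∀ i, EV A (i + 1) N K) :
    Function.Bijective (deltaMap A K N) := by
  refine ⟨?_, hK.deltaMap_surjective_of_ev hN⟩
  obtain ⟨n, π, hπ⟩ := Module.Finite.exists_fin' A N
  have hs := isSES_ker hπ
  rw [← LinearMap.ker_eq_bot, eq_bot_iff]
  intro y hy
  rw [mem_ker_deltaMap] at hy
  obtain ⟨x, rfl⟩ := hπ y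
  obtain ⟨ψ, hψ⟩ := exists_comp_eq (hs.dual (hN 0)).exact (hs.dual (hN 0)).surj
    (φ := deltaMap A K _ x) (LinearMap.ext hy)
  obtain ⟨l, rfl⟩ := hK.deltaMap_surjective_of_ev
    (fun i ↦ hs.ev_left (ev_of_projective i) (hN (i + 1))) ψ
  have : (l : Fin n → A) = x := (hK.deltaMap_pi_bijective n).1 hψ
  rw [← this]
  exact l.2

lemma ev_of_mcm (hK : Canonical A d K) [Module.Finite A N] (hN : DepthGE A d N) (i : ℕ) : EV A
    (i + 1) N K :=
  hK.ev_of_depthGE hN (by omega)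

lemma depthGE_dual (hK : Canonical A d K) (N : Type) [AddCommGroup N] [Module A N]
    [Module.Finite A N]
    (hN : DepthGE A d N) : DepthGE A d (N →ₗ[A] K) :=
  hK.depthGE_dual_of_ev d N (hK.ev_of_mcm hN) le_rfl

lemma deltaMap_bijective (hK : Canonical A d K) [Module.Finite A N] (hN : DepthGE A d N) :
    Function.Bijective (deltaMap A K N) :=
  hK.deltaMap_bijective_of_ev (hK.ev_of_mcm hN)

end Canonical

end Duality

section KrullDimension

variable {A : Type} [CommRing A]

lemma ringKrullDim_quotient_add_le (I : Ideal A) (n : ℕ)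
    (h : ∀ q : PrimeSpectrum A, I ≤ q.asIdeal → n ≤ Order.height q) :
    ringKrullDim (A ⧸ I) + n ≤ ringKrullDim A := by
  rw [ringKrullDim_quotient]
  have key (l : LTSeries (PrimeSpectrum.zeroLocus (I : Set A))) :
      ((l.length : ℕ∞) : WithBot ℕ∞) + n ≤ ringKrullDim A := by
    have : Nonempty (PrimeSpectrum A) := ⟨l.head⟩
    let l' := l.map Subtype.val (Subtype.strictMono_coe _)
    have h1 : (l.length : ℕ∞) ≤ Order.coheight l'.head := Order.length_le_coheight_head (p := l')
    have h2 : (n : ℕ∞) ≤ Order.height l'.head := by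
      refine h _ ?_
      rw [show l'.head = l.head.1 from LTSeries.head_map _ _ _]
      exact l.head.2
    rw [ringKrullDim, Order.krullDim_eq_iSup_height_add_coheight_of_nonempty, add_comm]
    exact_mod_cast (add_le_add h2 h1).trans
      (le_iSup (fun a : PrimeSpectrum A ↦ Order.height a + Order.coheight a) l'.head)
  obtain h0 | h0 := isEmpty_or_nonempty (PrimeSpectrum.zeroLocus (I : Set A))
  · rw [Order.krullDim_eq_bot, WithBot.bot_add]
    exact bot_le
  · rw [Order.krullDim_eq_iSup_length]
    rw [show ((n : ℕ) : WithBot ℕ∞) = ((n : ℕ∞) : WithBot ℕ∞) from rfl, ← WithBot.coe_add,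
      ENat.iSup_add]
    obtain ⟨m, hm⟩ : ∃ m : ℕ∞, ringKrullDim A = m :=
      have : Nonempty (PrimeSpectrum A) := ⟨h0.some.1⟩
      ⟨_, Order.krullDim_eq_iSup_length⟩
    rw [hm] at key ⊢
    exact WithBot.coe_le_coe.mpr (iSup_le fun l ↦ WithBot.coe_le_coe.mp (key l))

lemma ringKrullDim_localization_eq (p : PrimeSpectrum A) :
    ringKrullDim (Localization.AtPrime p.asIdeal) = Order.height p := by
  rw [IsLocalization.AtPrime.ringKrullDim_eq_height p.asIdeal (Localization.AtPrime p.asIdeal),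
    PrimeSpectrum.height_eq_orderHeight]

lemma exists_height_eq [IsNoetherianRing A] (p : PrimeSpectrum A) :
    ∃ h : ℕ, Order.height p = h := by
  rw [← PrimeSpectrum.height_eq_orderHeight]
  exact (ENat.ne_top_iff_exists.mp (Ideal.height_ne_top p.2.ne_top)).imp fun _ h ↦ h.symm

end KrullDimension

section Localization

variable {A : Type} [CommRing A] (S : Submonoid A)
  {M N Z L F K N' N'' : Type} [AddCommGroup M] [Module A M] [AddCommGroup N] [Module A N]
  [AddCommGroup Z] [Module A Z]
  [AddCommGroup L] [Module A L] [AddCommGroup F] [Module A F] [AddCommGroup K] [Module A K]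
  [AddCommGroup N'] [Module A N'] [AddCommGroup N''] [Module A N'']

lemma LocalizedModule.map_comp_apply (f : M →ₗ[A] N) (g : N →ₗ[A] L) (x : LocalizedModule S M) :
    LocalizedModule.map S g (LocalizedModule.map S f x) = LocalizedModule.map S (g ∘ₗ f) x := by
  induction x using LocalizedModule.induction_on with
  | h m s => simp [LocalizedModule.map_mk]

lemma IsSES.localized {f : N' →ₗ[A] N} {g : N →ₗ[A] N''} (h : IsSES f g) :
    IsSES (LocalizedModule.map S f) (LocalizedModule.map S g) :=
  ⟨LocalizedModule.map_injective S f h.inj, LocalizedModule.map_exact S f g h.exact,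
    LocalizedModule.map_surjective S g h.surj⟩

lemma linearMap_localizedModule_ext {P : Type} [AddCommGroup P] [Module (Localization S) P]
    {φ ψ : LocalizedModule S N →ₗ[Localization S] P}
    (h : ∀ n, φ (LocalizedModule.mk n 1) = ψ (LocalizedModule.mk n 1)) : φ = ψ := by
  ext x
  induction x using LocalizedModule.induction_on with
  | h n s =>
    have : LocalizedModule.mk n s = (Localization.mk 1 s) • (LocalizedModule.mk n 1) := by
      rw [LocalizedModule.mk_smul_mk]
      simp
    rw [this, map_smul, map_smul, h]

lemma isUnit_algebraMap_localization (s : S) : IsUnit (algebraMap A (Localization S) s) :=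
  IsLocalization.map_units _ s

/-- A map between localizations of finitely presented modules is, up to a unit, a localization. -/
lemma exists_smul_eq_localizedModule_map [Module.FinitePresentation A N]
    (φ : LocalizedModule S N →ₗ[Localization S] LocalizedModule S Z) :
    ∃ (ψ : N →ₗ[A] Z) (s : S), algebraMap A (Localization S) s • φ = LocalizedModule.map S ψ := by
  obtain ⟨ψ, s, hs⟩ := Module.FinitePresentation.exists_lift_of_isLocalizedModule S
    (LocalizedModule.mkLinearMap S Z)
    ((φ.restrictScalars A) ∘ₗ LocalizedModule.mkLinearMap S N)
  refine ⟨ψ, s, linearMap_localizedModule_ext S fun n ↦ ?_⟩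
  have := LinearMap.congr_fun hs n
  rw [LocalizedModule.map_mk]
  refine Eq.trans ?_ this.symm
  simp only [LinearMap.smul_apply, algebraMap_smul]
  rfl

lemma ev_localizedModule [IsNoetherianRing A] (i : ℕ) : ∀ (N : Type) [AddCommGroup N]
    [Module A N] [Module.Finite A N], EV A i N Z →
      EV (Localization S) i (LocalizedModule S N) (LocalizedModule S Z) := by
  induction i with
  | zero =>
    intro N _ _ _ h
    rw [ev_zero_iff_forall] at h ⊢
    intro φ
    have := Module.finitePresentation_of_finite A N
    obtain ⟨ψ, s, hs⟩ := exists_smul_eq_localizedModule_map S φ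
    rw [h ψ, map_zero] at hs
    exact (isUnit_algebraMap_localization S s).smul_eq_zero.mp hs
  | succ i ih =>
    intro N _ _ _ h
    obtain ⟨n, π, hπ⟩ := Module.Finite.exists_fin' A N
    have hs := isSES_ker hπ
    have hfree : Module.Free (Localization S) (LocalizedModule S (Fin n → A)) :=
      Module.free_of_isLocalizedModule S (LocalizedModule.mkLinearMap S (Fin n → A))
    cases i with
    | succ i =>
      exact (hs.localized S).ev_right (ih _ (hs.ev_left (ev_of_projective i) h))
        (ev_of_projective _)
    | zero =>
      refine (hs.localized S).ev_one_of_exists_extend (ev_of_projective 0) fun φ ↦ ?_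
      have := Module.finitePresentation_of_finite A (LinearMap.ker π)
      obtain ⟨ψ, s, hφ⟩ := exists_smul_eq_localizedModule_map S φ
      obtain ⟨ψ', rfl⟩ := hs.exists_extend h ψ
      obtain ⟨u, hu⟩ := isUnit_algebraMap_localization S s
      refine ⟨(↑u⁻¹ : Localization S) • LocalizedModule.map S ψ', ?_⟩
      rw [← hu] at hφ
      rw [LinearMap.smul_comp, show φ = (↑u⁻¹ : Localization S) • (u : Localization S) • φ by
        rw [smul_smul, Units.inv_mul, one_smul], hφ]
      congr 1
      ext x
      exact LocalizedModule.map_comp_apply S _ _ x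

lemma exists_smul_eq_of_localizedModule [IsNoetherianRing A] [Module.Finite A K]
    (hend : ∀ φ : K →ₗ[A] K, ∃ r : A, LinearMap.lsmul A K r = φ)
    (φ : LocalizedModule S K →ₗ[Localization S] LocalizedModule S K) :
    ∃ r : Localization S, LinearMap.lsmul _ _ r = φ := by
  have := Module.finitePresentation_of_finite A K
  obtain ⟨ψ, s, hs⟩ := exists_smul_eq_localizedModule_map S φ
  obtain ⟨r, rfl⟩ := hend ψ
  obtain ⟨u, hu⟩ := isUnit_algebraMap_localization S s
  rw [← hu] at hs
  refine ⟨↑u⁻¹ * algebraMap A _ r, ?_⟩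
  rw [show φ = (↑u⁻¹ : Localization S) • (u : Localization S) • φ by
        rw [smul_smul, Units.inv_mul, one_smul], hs]
  refine linearMap_localizedModule_ext S fun n ↦ ?_
  rw [LinearMap.lsmul_apply, LinearMap.smul_apply, LocalizedModule.map_mk, mul_smul,
    algebraMap_smul, LinearMap.lsmul_apply, LocalizedModule.smul'_mk]

lemma annihilator_localizedModule_eq_bot [Module.Finite A K]
    (h : Module.annihilator A K = ⊥) :
    Module.annihilator (Localization S) (LocalizedModule S K) = ⊥ := by
  rw [eq_bot_iff]
  intro x hx
  induction x using Localization.induction_on with | H y =>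
  obtain ⟨r, s⟩ := y
  have h1 : LocalizedModule.mkLinearMap S K ∘ₗ LinearMap.lsmul A K r =
      LocalizedModule.mkLinearMap S K ∘ₗ 0 := by
    ext k
    have := Module.mem_annihilator.mp hx (LocalizedModule.mk (s • k) 1)
    rw [LocalizedModule.mk_smul_mk, mul_one, smul_comm, LocalizedModule.mk_cancel] at this
    exact this.trans (map_zero (LocalizedModule.mkLinearMap S K)).symm
  obtain ⟨t, ht⟩ := Module.Finite.exists_smul_of_comp_eq_of_isLocalizedModule S _ _ _ h1
  have h2 : (t : A) * r ∈ Module.annihilator A K := Module.mem_annihilator.mpr fun k ↦ by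
    rw [mul_smul]
    exact (LinearMap.congr_fun ht k).trans (smul_zero _)
  rw [h, Ideal.mem_bot] at h2
  rw [Ideal.mem_bot, Localization.mk_eq_mk', IsLocalization.mk'_eq_zero_iff]
  exact ⟨t, h2⟩

end Localization

section AtPrime

open IsLocalRing

variable {A : Type} [CommRing A] (p : PrimeSpectrum A)
  {M N Z L F K N' N'' : Type} [AddCommGroup M] [Module A M] [AddCommGroup N] [Module A N]
  [AddCommGroup Z] [Module A Z] [AddCommGroup K] [Module A K]

/-- The localization of a module at a prime. -/
abbrev Loc (p : PrimeSpectrum A) (N : Type) [AddCommGroup N] [Module A N] : Type :=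
  LocalizedModule p.asIdeal.primeCompl N

instance finite_loc [Module.Finite A N] :
    Module.Finite (Localization.AtPrime p.asIdeal) (Loc p N) :=
  Module.Finite.of_isLocalizedModule p.asIdeal.primeCompl
    (LocalizedModule.mkLinearMap p.asIdeal.primeCompl N)

lemma nonempty_equiv_residueField_of_surjective {B V : Type} [CommRing B] [IsLocalRing B]
    [AddCommGroup V] [Module B V] [Nontrivial V] {f : B →ₗ[B] V} (hf : Function.Surjective f)
    (hm : ∀ b ∈ maximalIdeal B, f b = 0) : Nonempty (V ≃ₗ[B] ResidueField B) := by
  have h : LinearMap.ker f = maximalIdeal B := by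
    refine ((maximalIdeal.isMaximal B).eq_of_le (fun h ↦ ?_) hm).symm
    obtain ⟨v, hv⟩ := exists_ne (0 : V)
    obtain ⟨b, rfl⟩ := hf v
    exact hv (h ▸ Submodule.mem_top : b ∈ LinearMap.ker f)
  exact ⟨(f.quotKerEquivOfSurjective hf).symm ≪≫ₗ Submodule.quotEquivOfEq _ _ h⟩

lemma nonempty_loc_quotient_equiv_residueField :
    Nonempty (Loc p (A ⧸ p.asIdeal) ≃ₗ[Localization.AtPrime p.asIdeal]
      ResidueField (Localization.AtPrime p.asIdeal)) := by
  let v : Loc p (A ⧸ p.asIdeal) := LocalizedModule.mk 1 1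
  have : Nontrivial (Loc p (A ⧸ p.asIdeal)) := by
    refine ⟨v, 0, fun h ↦ ?_⟩
    rw [← LocalizedModule.zero_mk 1, LocalizedModule.mk_eq] at h
    obtain ⟨u, hu⟩ := h
    rw [one_smul, smul_zero, smul_zero] at hu
    exact u.2 (Ideal.Quotient.eq_zero_iff_mem.mp ((mul_one _).symm.trans hu))
  refine nonempty_equiv_residueField_of_surjective (f := LinearMap.toSpanSingleton _ _ v)
    (fun x ↦ ?_) fun b hb ↦ ?_
  · induction x using LocalizedModule.induction_on with
    | h q s =>
      obtain ⟨r, rfl⟩ := Ideal.Quotient.mk_surjective q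
      refine ⟨Localization.mk r s, ?_⟩
      rw [LinearMap.toSpanSingleton_apply, LocalizedModule.mk_smul_mk, mul_one]
      congr 1
      exact mul_one (Ideal.Quotient.mk p.asIdeal r)
  · induction b using Localization.induction_on with | H y =>
    obtain ⟨r, s⟩ := y
    rw [Localization.mk_eq_mk', IsLocalization.AtPrime.mk'_mem_maximal_iff _ p.asIdeal] at hb
    rw [LinearMap.toSpanSingleton_apply, LocalizedModule.mk_smul_mk, mul_one]
    rw [show r • (1 : A ⧸ p.asIdeal) = 0 from
      (mul_one _).trans (Ideal.Quotient.eq_zero_iff_mem.mpr hb), LocalizedModule.zero_mk]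

/-- The localization of the ring, as a module, is the localized ring. -/
lemma nonempty_loc_self_equiv :
    Nonempty (Loc p A ≃ₗ[Localization.AtPrime p.asIdeal] Localization.AtPrime p.asIdeal) :=
  ⟨(IsLocalizedModule.iso p.asIdeal.primeCompl
    (Algebra.linearMap A (Localization.AtPrime p.asIdeal))).extendScalarsOfIsLocalization
      p.asIdeal.primeCompl _⟩

lemma depthGE_loc [IsLocalRing A] [IsNoetherianRing A] [Module.Finite A Z] {d h : ℕ}
    (hdim : ringKrullDim A = d) (hZ : DepthGE A d Z) (hp : Order.height p = h) :
    DepthGE (Localization.AtPrime p.asIdeal) h (Loc p Z) := by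
  intro i hi
  obtain ⟨e⟩ := nonempty_loc_quotient_equiv_residueField p
  refine EV.congr_left (ev_localizedModule p.asIdeal.primeCompl i (A ⧸ p.asIdeal) ?_) e
  have h1 := ringKrullDim_quotient_add_le p.asIdeal h fun q hq ↦ hp ▸ Order.height_mono hq
  rw [← Module.supportDim_quotient_eq_ringKrullDim, hdim] at h1
  have h2 : h ≤ d := by
    have := Order.height_le_krullDim p
    rw [hp, ← ringKrullDim, hdim] at this
    exact_mod_cast this
  refine ev_of_supportDim_le hZ (d - h) _ i ?_ (by omega)
  generalize Module.supportDim A (A ⧸ p.asIdeal) = s at h1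
  induction s using WithBot.recBotCoe with
  | bot => exact bot_le
  | coe s =>
    have h3 : s + h ≤ d := by exact_mod_cast h1
    have h4 : s ≤ ((d - h : ℕ) : ℕ∞) := by
      rw [ENat.natCast_sub]
      exact ENat.le_sub_of_add_le_right (ENat.natCast_ne_top h) h3
    exact WithBot.coe_le_coe.mpr h4

lemma fid_loc [IsNoetherianRing A] (h : HasFID A K) : ∃ b : ℕ, ∀ (N : Type) [AddCommGroup N]
    [Module (Localization.AtPrime p.asIdeal) N], ∀ m > b,
      EV (Localization.AtPrime p.asIdeal) m N (Loc p K) := by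
  obtain ⟨n, hn⟩ := h
  have : HasInjectiveDimensionLT (ModuleCat.of A K) (n + 1) := by
    rw [hasInjectiveDimensionLT_iff]
    intro i hi Y e
    exact ((subsingleton_ext1_iff i).mp (hn Y i hi)).eq_zero e
  have h2 := (ModuleCat.of A K).localizedModule_hasInjectiveDimensionLE n p.asIdeal.primeCompl
  have h2 := (hasInjectiveDimensionLT_iff _ _).mp h2
  refine ⟨n, fun N _ _ m hm ↦ ?_⟩
  have : EV (Localization.AtPrime p.asIdeal) m N
      (Shrink (LocalizedModule p.asIdeal.primeCompl K)) :=
    subsingleton_of_forall_eq 0 fun x ↦ h2 m hm x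
  exact this.congr_right (Shrink.linearEquiv (Localization.AtPrime p.asIdeal) _)

lemma Canonical.loc [IsLocalRing A] [IsNoetherianRing A] {d h : ℕ} (hK : Canonical A d K)
    (hfid : HasFID A K) (hp : Order.height p = h) :
    Canonical (Localization.AtPrime p.asIdeal) h (Loc p K) := by
  have := hK.finite
  obtain ⟨e⟩ := nonempty_loc_self_equiv p
  refine ⟨?_, (depthGE_loc p hK.dim_eq hK.depth_ring hp).congr e, inferInstance,
    depthGE_loc p hK.dim_eq hK.depth hp, ?_, exists_smul_eq_of_localizedModule _ hK.end_eq,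
    annihilator_localizedModule_eq_bot _ hK.faithful⟩
  · rw [ringKrullDim_localization_eq, hp]
    rfl
  · obtain ⟨b, hb⟩ := fid_loc p hfid
    exact ⟨b, fun N _ _ _ m hm ↦ hb N m hm⟩

end AtPrime

lemma HasFID.congr {A N N' : Type} [CommRing A] [AddCommGroup N] [Module A N] [AddCommGroup N']
    [Module A N'] (h : HasFID A N) (e : N ≃ₗ[A] N') : HasFID A N' := by
  obtain ⟨n, hn⟩ := h
  refine ⟨n, fun P _ _ m hm ↦ (subsingleton_ext1_iff m).mpr ?_⟩
  exact ((subsingleton_ext1_iff m).mp (hn P m hm)).congr_right e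

section Serre

open IsLocalRing

variable {A : Type} [CommRing A] [IsNoetherianRing A] (p : PrimeSpectrum A)
  {M N Z L F K N' N'' : Type} [AddCommGroup M] [Module A M] [AddCommGroup N] [Module A N]
  [AddCommGroup Z] [Module A Z] [AddCommGroup K] [Module A K]
  [AddCommGroup N'] [Module A N'] [AddCommGroup N''] [Module A N'']

lemma serreS_iff (n : ℕ) : SerreS A n N ↔ ∀ (p : PrimeSpectrum A) (h : ℕ), Order.height p = h →
    DepthGE (Localization.AtPrime p.asIdeal) (min n h) (Loc p N) := by
  refine forall_congr' fun p ↦ ?_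
  obtain ⟨h, hp⟩ := exists_height_eq p
  rw [ringKrullDim_localization_eq, hp]
  have : min (n : WithBot ℕ∞) ((h : ℕ∞) : WithBot ℕ∞) = ((min n h : ℕ) : ℕ∞) := by
    rcases le_total n h with hnh | hnh
    · rw [min_eq_left hnh]
      exact min_eq_left (by exact_mod_cast hnh)
    · rw [min_eq_right hnh]
      exact min_eq_right (by exact_mod_cast hnh)
  rw [this, WithBot.coe_le_coe, le_rdepth_iff]
  refine ⟨fun H h' hh ↦ ?_, fun H ↦ H h rfl⟩
  rwa [← ENat.natCast_inj.mp hh]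

/-- The localization of an isomorphism. -/
noncomputable def locCongr (e : N ≃ₗ[A] N') :
    Loc p N ≃ₗ[Localization.AtPrime p.asIdeal] Loc p N' :=
  LinearEquiv.ofBijective (LocalizedModule.map _ e.toLinearMap)
    ⟨LocalizedModule.map_injective _ _ e.injective, LocalizedModule.map_surjective _ _ e.surjective⟩

lemma SerreS.congr {n : ℕ} (h : SerreS A n N) (e : N ≃ₗ[A] N') : SerreS A n N' := by
  rw [serreS_iff] at h ⊢
  exact fun p m hp ↦ (h p m hp).congr (locCongr p e)

lemma subsingleton_of_depthGE_loc (n : ℕ)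
    (h0 : ∀ (p : PrimeSpectrum A) (h : ℕ), Order.height p = h → h < n → Subsingleton (Loc p N))
    (h1 : ∀ (p : PrimeSpectrum A) (h : ℕ), Order.height p = h → n ≤ h →
      DepthGE (Localization.AtPrime p.asIdeal) 1 (Loc p N)) : Subsingleton N := by
  by_contra hN
  rw [not_subsingleton_iff_nontrivial] at hN
  obtain ⟨I, hI⟩ := associatedPrimes.nonempty A N
  obtain ⟨hp, f, hf⟩ := (isAssociatedPrime_iff_exists_injective_linearMap _ _).mp hI
  let p : PrimeSpectrum A := ⟨I, hp⟩
  obtain ⟨h, hp⟩ := exists_height_eq p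
  obtain ⟨e⟩ := nonempty_loc_quotient_equiv_residueField p
  have hinj : Function.Injective (LocalizedModule.map p.asIdeal.primeCompl f) :=
    LocalizedModule.map_injective _ _ hf
  have : Nontrivial (Loc p (A ⧸ p.asIdeal)) := e.toEquiv.nontrivial
  have := hinj.nontrivial
  obtain hn | hn := lt_or_ge h n
  · exact not_subsingleton (Loc p N) (h0 p h hp hn)
  · have h2 := ((h1 p h hp hn) 0 one_pos).congr_left e.symm
    rw [ev_zero_iff_forall] at h2
    obtain ⟨x, hx⟩ := exists_ne (0 : Loc p (A ⧸ p.asIdeal))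
    exact hx (hinj ((LinearMap.congr_fun (h2 _) x).trans (map_zero _).symm))

lemma codGT_of_subsingleton_loc {d : ℕ} (hdim : ringKrullDim A = d) [Module.Finite A N] (n : ℕ)
    (h0 : ∀ (p : PrimeSpectrum A) (h : ℕ), Order.height p = h → h ≤ n → Subsingleton (Loc p N)) :
    codGT A d N n := by
  have := ringKrullDim_quotient_add_le (Module.annihilator A N) (n + 1) fun q hq ↦ by
    obtain ⟨h, hh⟩ := exists_height_eq q
    rw [hh]
    by_contra hc
    have hq' : q ∈ Module.support A N := by
      rw [Module.support_eq_zeroLocus]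
      exact hq
    have := Module.mem_support_iff.mp hq'
    exact not_subsingleton _ (h0 q h hh (by
      rw [not_le] at hc
      exact Nat.lt_succ_iff.mp (by exact_mod_cast hc)))
  rw [hdim] at this
  unfold codGT mdim
  generalize ringKrullDim (A ⧸ Module.annihilator A N) = s at this ⊢
  induction s using WithBot.recBotCoe with
  | bot => exact WithBot.bot_lt_coe _
  | coe s =>
    induction s using ENat.recTopCoe with
    | top =>
      change (((⊤ : ℕ∞) + (n + 1 : ℕ) : ℕ∞) : WithBot ℕ∞) ≤ ((d : ℕ∞) : WithBot ℕ∞) at this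
      rw [WithBot.coe_le_coe, top_add, top_le_iff] at this
      exact absurd this (ENat.natCast_ne_top d)
    | coe s =>
      have h3 : s + (n + 1) ≤ d := by exact_mod_cast this
      have h4 : s + n < d := by omega
      exact_mod_cast h4

lemma codGT.ev [IsLocalRing A] {d n i : ℕ} [Module.Finite A N] (h : codGT A d N n) (hi : i ≤ n)
    [Module.Finite A Z] (hZ : DepthGE A d Z) : EV A i N Z := by
  unfold codGT mdim at h
  rw [← Module.supportDim_eq_ringKrullDim_quotient_annihilator] at h
  generalize hs : Module.supportDim A N = s at h
  induction s using WithBot.recBotCoe with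
  | bot =>
    have := (Module.supportDim_eq_bot_iff_subsingleton A N).mp hs
    exact ev_of_subsingleton_left i
  | coe s =>
    induction s using ENat.recTopCoe with
    | top =>
      change (((⊤ : ℕ∞) + (n : ℕ) : ℕ∞) : WithBot ℕ∞) < ((d : ℕ∞) : WithBot ℕ∞) at h
      rw [WithBot.coe_lt_coe, top_add] at h
      exact absurd h not_top_lt
    | coe s =>
      have h3 : s + n < d := by exact_mod_cast h
      exact ev_of_supportDim_le hZ s N i hs.le (by omega)

end Serre

section LocalDuality

open IsLocalRing

variable {A : Type} [CommRing A] [IsNoetherianRing A] (p : PrimeSpectrum A)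
  {N K : Type} [AddCommGroup N] [Module A N] [AddCommGroup K] [Module A K] [Module.Finite A N]

lemma subsingleton_loc_ker_deltaMap
    (h : Function.Injective (deltaMap (Localization.AtPrime p.asIdeal) (Loc p K) (Loc p N))) :
    Subsingleton (Loc p (LinearMap.ker (deltaMap A K N))) := by
  rw [LocalizedModule.subsingleton_iff]
  rintro ⟨n, hn⟩
  rw [mem_ker_deltaMap] at hn
  have h0 : (LocalizedModule.mk n 1 : Loc p N) = 0 := by
    refine h ((LinearMap.ext fun φ ↦ ?_).trans (map_zero _).symm)
    have := Module.finitePresentation_of_finite A N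
    obtain ⟨ψ, s, hs⟩ := exists_smul_eq_localizedModule_map p.asIdeal.primeCompl φ
    refine (isUnit_algebraMap_localization p.asIdeal.primeCompl s).smul_eq_zero.mp ?_
    change (algebraMap A (Localization.AtPrime p.asIdeal) s • φ) (LocalizedModule.mk n 1) = 0
    rw [hs, LocalizedModule.map_mk, hn, LocalizedModule.zero_mk]
  obtain ⟨u, hu⟩ := LocalizedModule.mk_eq.mp (h0.trans (LocalizedModule.zero_mk 1).symm)
  rw [one_smul, smul_zero, smul_zero] at hu
  exact ⟨u, u.2, Subtype.ext hu⟩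

lemma exists_smul_eq_deltaMap [Module.Finite A K]
    (h : Function.Surjective (deltaMap (Localization.AtPrime p.asIdeal) (Loc p K) (Loc p N)))
    (φ : (N →ₗ[A] K) →ₗ[A] K) : ∃ t ∈ p.asIdeal.primeCompl, ∃ n, t • φ = deltaMap A K N n := by
  have := Module.finitePresentation_of_finite A N
  let Φ := IsLocalizedModule.mapExtendScalars p.asIdeal.primeCompl
    (LocalizedModule.map p.asIdeal.primeCompl (M := N) (N := K))
    (LocalizedModule.mkLinearMap p.asIdeal.primeCompl K) (Localization.AtPrime p.asIdeal) φ
  have hΦ (ψ : N →ₗ[A] K) : Φ (LocalizedModule.map p.asIdeal.primeCompl ψ) =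
      LocalizedModule.mk (φ ψ) 1 :=
    IsLocalizedModule.map_apply p.asIdeal.primeCompl _ _ φ ψ
  obtain ⟨y, hy⟩ := h Φ
  induction y using LocalizedModule.induction_on with
  | h n s =>
  have h1 : LocalizedModule.mkLinearMap p.asIdeal.primeCompl K ∘ₗ ((s : A) • φ) =
      LocalizedModule.mkLinearMap p.asIdeal.primeCompl K ∘ₗ (deltaMap A K N n) := by
    ext ψ
    have h2 : LocalizedModule.mk (ψ n) s = LocalizedModule.mk (φ ψ) 1 := by
      rw [← hΦ, ← hy, deltaMap_apply, LocalizedModule.map_mk]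
    change LocalizedModule.mk ((s : A) • φ ψ) 1 = LocalizedModule.mk (ψ n) 1
    rw [← LocalizedModule.smul'_mk, ← h2, LocalizedModule.smul'_mk]
    exact LocalizedModule.mk_cancel s (ψ n)
  obtain ⟨t, ht⟩ := Module.Finite.exists_smul_of_comp_eq_of_isLocalizedModule
    p.asIdeal.primeCompl _ _ _ h1
  refine ⟨t * s, mul_mem t.2 s.2, (t : A) • n, ?_⟩
  rw [mul_smul, map_smul]
  exact ht

lemma subsingleton_loc_coker_deltaMap [Module.Finite A K]
    (h : Function.Surjective (deltaMap (Localization.AtPrime p.asIdeal) (Loc p K) (Loc p N))) :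
    Subsingleton (Loc p (((N →ₗ[A] K) →ₗ[A] K) ⧸ LinearMap.range (deltaMap A K N))) := by
  rw [LocalizedModule.subsingleton_iff]
  intro x
  obtain ⟨φ, rfl⟩ := Submodule.mkQ_surjective _ x
  obtain ⟨t, ht, n, hn⟩ := exists_smul_eq_deltaMap p h φ
  exact ⟨t, ht, by rw [← map_smul, hn]; exact (Submodule.Quotient.mk_eq_zero _).mpr ⟨n, rfl⟩⟩

end LocalDuality

lemma SerreS.depthGE {A N : Type} [CommRing A] [IsNoetherianRing A] [AddCommGroup N]
    [Module A N] {n : ℕ} (hN : SerreS A n N) {p : PrimeSpectrum A} {h : ℕ}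
    (hp : Order.height p = h) {m : ℕ} (hmn : m ≤ n) (hmh : m ≤ h) :
    DepthGE (Localization.AtPrime p.asIdeal) m (Loc p N) :=
  ((serreS_iff n).mp hN p h hp).mono (le_min hmn hmh)

section SerreDual

open IsLocalRing

variable {A : Type} [CommRing A] [IsNoetherianRing A] [IsLocalRing A] {d : ℕ}
  {N K : Type} [AddCommGroup N] [Module A N] [AddCommGroup K] [Module A K] [Module.Finite A N]

namespace Canonical

lemma depthGE_loc_dual_pi (hK : Canonical A d K) {p : PrimeSpectrum A} {h : ℕ}
    (hp : Order.height p = h) (n : ℕ) :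
    DepthGE (Localization.AtPrime p.asIdeal) h (Loc p ((Fin n → A) →ₗ[A] K)) :=
  have := hK.finite
  depthGE_loc p hK.dim_eq (hK.depthGE_dual_pi n) hp

lemma depthGE_one_loc_dual (hK : Canonical A d K) {p : PrimeSpectrum A} {h : ℕ}
    (hp : Order.height p = h) (h1 : 1 ≤ h) :
    DepthGE (Localization.AtPrime p.asIdeal) 1 (Loc p (N →ₗ[A] K)) := by
  obtain ⟨n, π, hπ⟩ := Module.Finite.exists_fin' A N
  exact DepthGE.of_injective (LocalizedModule.map_injective _ _ (dmap_injective hπ))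
    ((hK.depthGE_loc_dual_pi hp n).mono h1)

lemma serreS_two_dual (hK : Canonical A d K) : SerreS A 2 (N →ₗ[A] K) := by
  rw [serreS_iff]
  intro p h hp
  obtain h0 | h1 | h2 : h = 0 ∨ h = 1 ∨ 2 ≤ h := by omega
  · subst h0
    exact depthGE_zero
  · exact (hK.depthGE_one_loc_dual hp h1.ge).mono (by omega)
  obtain ⟨n, π, hπ⟩ := Module.Finite.exists_fin' A N
  have hex := exact_dmap (K := K) (isSES_ker hπ).exact hπ
  have hs := (isSES_range (dmap_injective (K := K) hπ)).localized p.asIdeal.primeCompl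
  have hinj : Function.Injective ((LinearMap.range (dmap A K π)).liftQ
      (dmap A K (LinearMap.ker π).subtype) hex.linearMap_ker_eq.ge) :=
    LinearMap.ker_eq_bot.mp (Submodule.ker_liftQ_eq_bot _ _ _ hex.linearMap_ker_eq.le)
  refine DepthGE.mono (hs.depthGE_left ((hK.depthGE_loc_dual_pi hp n).mono h2) ?_) (min_le_left 2 h)
  exact DepthGE.of_injective (LocalizedModule.map_injective _ _ hinj)
    (hK.depthGE_one_loc_dual hp (by omega))

lemma deltaMap_bijective_of_serreS (hK : Canonical A d K) (hfid : HasFID A K) (hN : SerreS A 2 N) :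
    Function.Bijective (deltaMap A K N) := by
  have := hK.finite
  have hloc (p : PrimeSpectrum A) (h : ℕ) (hp : Order.height p = h) (h2 : h < 2) :
      Function.Bijective (deltaMap (Localization.AtPrime p.asIdeal) (Loc p K) (Loc p N)) :=
    (hK.loc p hfid hp).deltaMap_bijective (hN.depthGE hp h2.le le_rfl)
  have hinj : Function.Injective (deltaMap A K N) := by
    rw [← LinearMap.ker_eq_bot, ← Submodule.subsingleton_iff_eq_bot]
    refine subsingleton_of_depthGE_loc (A := A) 1 (fun p h hp h1 ↦ ?_) fun p h hp h1 ↦ ?_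
    · exact subsingleton_loc_ker_deltaMap p (hloc p h hp (by omega)).1
    · exact DepthGE.of_injective
        (LocalizedModule.map_injective _ _ (LinearMap.ker (deltaMap A K N)).injective_subtype)
        (hN.depthGE hp one_le_two h1)
  refine ⟨hinj, ?_⟩
  rw [← LinearMap.range_eq_top, ← Submodule.Quotient.subsingleton_iff]
  refine subsingleton_of_depthGE_loc (A := A) 2 (fun p h hp h1 ↦ ?_) fun p h hp h2 ↦ ?_
  · exact subsingleton_loc_coker_deltaMap p (hloc p h hp h1).2
  · exact ((isSES_range hinj).localized p.asIdeal.primeCompl).depthGE_right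
      (hK.depthGE_one_loc_dual hp (by omega)) (hN.depthGE hp le_rfl h2)

end Canonical

end SerreDual

section FiniteInjectiveDimension

variable {A : Type} [CommRing A] {K : Type} [AddCommGroup K] [Module A K]

lemma ev_of_injective (N : Type) [AddCommGroup N] [Module A N] [Injective (ModuleCat.of A K)]
    (i : ℕ) : EV A (i + 1) N K :=
  subsingleton_of_forall_eq 0 fun x ↦ x.eq_zero_of_injective

lemma injective_of_ev (h : ∀ I : Ideal A, EV A 1 (A ⧸ I) K) : Injective (ModuleCat.of A K) := by
  rw [← Module.injective_iff_injective_object]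
  refine Module.Baer.injective fun I g ↦ ?_
  obtain ⟨ψ, hψ⟩ := (isSES_mkQ I).exists_extend (h I) g
  exact ⟨ψ, fun x hx ↦ LinearMap.congr_fun hψ ⟨x, hx⟩⟩

lemma ev_of_forall_finite (j : ℕ) : ∀ (K : Type) [AddCommGroup K] [Module A K],
    (∀ (N : Type) [AddCommGroup N] [Module A N] [Module.Finite A N], EV A (j + 1) N K) →
    ∀ (N : Type) [AddCommGroup N] [Module A N], ∀ m > j, EV A m N K := by
  induction j with
  | zero =>
    intro K _ _ h N _ _ m hm
    have := injective_of_ev fun I ↦ h (A ⧸ I)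
    obtain ⟨m, rfl⟩ := Nat.exists_eq_succ_of_ne_zero hm.ne'
    exact ev_of_injective N m
  | succ j ih =>
    intro K _ _ h N _ _ m hm
    let I : ModuleCat A := Injective.under (ModuleCat.of A K)
    have hI : Injective (ModuleCat.of A I) := inferInstanceAs (Injective (Injective.under _))
    have hs := isSES_range (f := (Injective.ι (ModuleCat.of A K)).hom)
      ((ModuleCat.mono_iff_injective _).mp inferInstance)
    obtain ⟨m, rfl⟩ := Nat.exists_eq_succ_of_ne_zero (by omega : m ≠ 0)
    refine hs.ev_left' (ih _ (fun N _ _ _ ↦ ?_) N m (by omega)) (ev_of_injective N m)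
    exact hs.ev_right' (ev_of_injective N j) (h N)

variable [IsLocalRing A]

lemma depthGE_pi {d : ℕ} (h : DepthGE A d A) (n : ℕ) : DepthGE A d (Fin n → A) :=
  fun i hi ↦ ev_pi (h i hi)

variable [IsNoetherianRing A]

lemma ev_of_ev_mcm {d : ℕ} (hdep : DepthGE A d A)
    (h : ∀ (Z : Type) [AddCommGroup Z] [Module A Z] [Module.Finite A Z], DepthGE A d Z →
      EV A 1 Z K) (j : ℕ) : ∀ t, t + j = d → ∀ (N : Type) [AddCommGroup N] [Module A N]
      [Module.Finite A N], DepthGE A t N → EV A (j + 1) N K := by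
  induction j with
  | zero =>
    rintro t rfl N _ _ _ hN
    exact h N hN
  | succ j ih =>
    intro t ht N _ _ _ hN
    obtain ⟨n, π, hπ⟩ := Module.Finite.exists_fin' A N
    have hs := isSES_ker hπ
    refine hs.ev_right (ih (t + 1) (by omega) _ ?_) (ev_of_projective (j + 1))
    exact hs.depthGE_left ((depthGE_pi hdep n).mono (by omega)) hN

lemma hasFID_of_ev_mcm {d : ℕ} (hdep : DepthGE A d A)
    (h : ∀ (Z : Type) [AddCommGroup Z] [Module A Z] [Module.Finite A Z], DepthGE A d Z →
      EV A 1 Z K) : HasFID A K :=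
  ⟨d, fun N _ _ m hm ↦ (subsingleton_ext1_iff m).mpr <| ev_of_forall_finite d K
    (fun N _ _ _ ↦ ev_of_ev_mcm hdep h d 0 (zero_add d) N depthGE_zero) N m hm⟩

end FiniteInjectiveDimension

section DualExt

variable {A : Type} [CommRing A] {T W K : Type} [AddCommGroup T] [Module A T] [AddCommGroup W]
  [Module A W] [AddCommGroup K] [Module A K]

/-- `Ext¹(T, W†)` vanishes together with `Ext¹(W, T†)`. -/
lemma ev_one_dual_comm [Module.Finite A T] (hT : EV A 1 T K) (hW : EV A 1 W (T →ₗ[A] K)) :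
    EV A 1 T (W →ₗ[A] K) := by
  obtain ⟨n, π, hπ⟩ := Module.Finite.exists_fin' A T
  have hs := isSES_ker hπ
  refine hs.ev_one_of_exists_extend (ev_of_projective 0) fun φ ↦ ?_
  obtain ⟨ψ, hψ⟩ := (hs.dual hT).exists_lift hW φ.flip
  refine ⟨ψ.flip, LinearMap.ext₂ fun l w ↦ ?_⟩
  exact LinearMap.congr_fun (LinearMap.congr_fun hψ w) l

variable [IsNoetherianRing A]

lemma exists_smul_eq_comp (p : PrimeSpectrum A) [Module.Finite A W] [Module.Finite A T]
    (f : W →ₗ[A] T) (φ : W →ₗ[A] K)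
    (h : ∃ Ψ, Ψ ∘ₗ LocalizedModule.map p.asIdeal.primeCompl f =
      LocalizedModule.map p.asIdeal.primeCompl φ) :
    ∃ t ∈ p.asIdeal.primeCompl, ∃ ψ : T →ₗ[A] K, t • φ = ψ ∘ₗ f := by
  obtain ⟨Ψ, hΨ⟩ := h
  have := Module.finitePresentation_of_finite A T
  obtain ⟨ψ, s, hs⟩ := exists_smul_eq_localizedModule_map p.asIdeal.primeCompl Ψ
  have h1 : LocalizedModule.mkLinearMap p.asIdeal.primeCompl K ∘ₗ ((s : A) • φ) =
      LocalizedModule.mkLinearMap p.asIdeal.primeCompl K ∘ₗ (ψ ∘ₗ f) := by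
    ext l
    have h2 := LinearMap.congr_fun hs
      (LocalizedModule.map p.asIdeal.primeCompl f (LocalizedModule.mk l 1))
    rw [LinearMap.smul_apply, ← LinearMap.comp_apply Ψ, hΨ, LocalizedModule.map_mk,
      LocalizedModule.map_mk, LocalizedModule.map_mk] at h2
    refine Eq.trans ?_ h2
    rw [algebraMap_smul]
    exact (LocalizedModule.smul'_mk _ _ _).symm
  obtain ⟨t, ht⟩ := Module.Finite.exists_smul_of_comp_eq_of_isLocalizedModule
    p.asIdeal.primeCompl _ _ _ h1
  refine ⟨t * s, mul_mem t.2 s.2, (t : A) • ψ, ?_⟩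
  rw [mul_smul]
  exact ht

lemma Canonical.ev_one_of_serreS [IsLocalRing A] {d : ℕ} [Module.Finite A T]
    (hK : Canonical A d K) (hfid : HasFID A K) (hT : SerreS A 2 T)
    (hT' : SerreS A 3 (T →ₗ[A] K)) : EV A 1 T K := by
  have := hK.finite
  obtain ⟨n, π, hπ⟩ := Module.Finite.exists_fin' A T
  have hs := isSES_ker hπ
  have hex := exact_dmap (K := K) hs.exact hπ
  let g := (LinearMap.range (dmap A K π)).liftQ (dmap A K (LinearMap.ker π).subtype)
    hex.linearMap_ker_eq.ge
  have hg : Function.Injective g :=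
    LinearMap.ker_eq_bot.mp (Submodule.ker_liftQ_eq_bot _ _ _ hex.linearMap_ker_eq.le)
  have h0 : Subsingleton ((LinearMap.ker π →ₗ[A] K) ⧸ LinearMap.range g) := by
    refine subsingleton_of_depthGE_loc (A := A) 3 (fun p h hp h3 ↦ ?_) fun p h hp h3 ↦ ?_
    · have h1 := (hK.loc p hfid hp).ev_of_mcm (hT.depthGE hp (by omega) le_rfl) 0
      rw [LocalizedModule.subsingleton_iff]
      intro x
      obtain ⟨φ, rfl⟩ := Submodule.mkQ_surjective _ x
      obtain ⟨t, ht, ψ, hψ⟩ := exists_smul_eq_comp p _ φ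
        ((hs.localized p.asIdeal.primeCompl).exists_extend h1 _)
      refine ⟨t, ht, ?_⟩
      rw [← map_smul, hψ]
      exact (Submodule.Quotient.mk_eq_zero _).mpr ⟨Submodule.Quotient.mk ψ, rfl⟩
    · have h1 := ((isSES_range (dmap_injective (K := K) hπ)).localized
        p.asIdeal.primeCompl).depthGE_right ((hK.depthGE_loc_dual_pi hp n).mono (by omega))
        (hT'.depthGE hp le_rfl h3)
      exact ((isSES_range hg).localized p.asIdeal.primeCompl).depthGE_right
        (hK.depthGE_one_loc_dual hp (by omega)) h1
  refine hs.ev_one_of_exists_extend (ev_of_projective 0) fun φ ↦ ?_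
  rw [Submodule.Quotient.subsingleton_iff] at h0
  obtain ⟨v, rfl⟩ := (h0 ▸ Submodule.mem_top : φ ∈ LinearMap.range g)
  obtain ⟨ψ, rfl⟩ := Submodule.mkQ_surjective _ v
  exact ⟨ψ, rfl⟩

end DualExt

section Preenvelope

variable {A : Type} [CommRing A] [IsLocalRing A] {d : ℕ}
  {C S T U Z M X K : Type} [AddCommGroup C] [Module A C] [AddCommGroup S] [Module A S]
  [AddCommGroup T] [Module A T] [AddCommGroup U] [Module A U] [AddCommGroup Z] [Module A Z]
  [AddCommGroup M] [Module A M] [AddCommGroup X] [Module A X] [AddCommGroup K] [Module A K]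

lemma IsMCM.depthGE (h : IsMCM A d Z) : DepthGE A d Z :=
  (le_rdepth_iff d).mp h.2

lemma isMCM_of_depthGE [Module.Finite A Z] (h : DepthGE A d Z) : IsMCM A d Z :=
  ⟨inferInstance, (le_rdepth_iff d).mpr h⟩

variable [IsNoetherianRing A]

lemma IsCanonicalModule.canonical (hdim : ringKrullDim A = d) (hdep : DepthGE A d A)
    (h : IsCanonicalModule A d K) : Canonical A d K := by
  obtain ⟨hmcm, ⟨b, hb⟩, ⟨e⟩⟩ := h
  have := hmcm.1
  have hb' (N : Type) [AddCommGroup N] [Module A N] [Module.Finite A N] (m : ℕ) (hm : m > b) :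
      EV A m N K := (subsingleton_ext1_iff m).mp (hb N m hm)
  obtain ⟨h1, h2⟩ := exists_smul_eq_of_canonical hdim hdep hmcm.depthGE
    (ev_of_gt_dim hdim hdep hb' (b + 1) _ (d + 1) (by omega) (by omega))
    ((ext1LinearEquiv A _ K d).symm ≪≫ₗ e)
  exact ⟨hdim, hdep, hmcm.1, hmcm.depthGE, ⟨b, hb'⟩, h1, h2⟩

namespace Canonical

lemma codGT_zero_of_le_ker_deltaMap (hK : Canonical A d K) (hfid : HasFID A K) [Module.Finite A M]
    {L : Submodule A M}
    (hL : L ≤ LinearMap.ker (deltaMap A K M)) : codGT A d L 0 := by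
  refine codGT_of_subsingleton_loc hK.dim_eq 0 fun p h hp h0 ↦ ?_
  obtain rfl : h = 0 := by omega
  have := subsingleton_loc_ker_deltaMap p
    ((hK.loc p hfid hp).deltaMap_bijective (N := Loc p M) depthGE_zero).1
  exact (LocalizedModule.map_injective p.asIdeal.primeCompl _
    (Submodule.inclusion_injective hL)).subsingleton

section

variable [Module.Finite A C]

lemma codGT_one_ker_deltaMap (hK : Canonical A d K) (hfid : HasFID A K)
    (hC : EV A 1 C K) : codGT A d (LinearMap.ker (deltaMap A K C)) 1 := by
  refine codGT_of_subsingleton_loc hK.dim_eq 1 fun p h hp h1 ↦ ?_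
  refine subsingleton_loc_ker_deltaMap p ((hK.loc p hfid hp).deltaMap_bijective_of_ev ?_).1
  rintro (_ | i)
  · exact ev_localizedModule _ 1 C hC
  · exact (hK.loc p hfid hp).ev_of_lt (by omega)

lemma codGT_two_coker_deltaMap (hK : Canonical A d K) (hfid : HasFID A K)
    (hC : EV A 1 C K) :
    codGT A d (((C →ₗ[A] K) →ₗ[A] K) ⧸ LinearMap.range (deltaMap A K C)) 2 := by
  have := hK.finite
  let q := (LinearMap.ker (deltaMap A K C)).mkQ
  have hq := isSES_mkQ (LinearMap.ker (deltaMap A K C))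
  have hq' : Function.Surjective (dmap A K q) := fun φ ↦ exists_comp_eq hq.exact hq.surj
    (LinearMap.ext fun x ↦ mem_ker_deltaMap.mp x.2 φ)
  have hC' : EV A 1 (C ⧸ LinearMap.ker (deltaMap A K C)) K :=
    hq.ev_right ((hK.codGT_one_ker_deltaMap hfid hC).ev zero_le_one hK.depth) hC
  let f := (LinearMap.ker (deltaMap A K C)).liftQ (deltaMap A K C) le_rfl
  have hf : Function.Injective f :=
    LinearMap.ker_eq_bot.mp (Submodule.ker_liftQ_eq_bot _ _ _ le_rfl)
  refine codGT_of_subsingleton_loc hK.dim_eq 2 fun p h hp h2 ↦ ?_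
  have hKp := hK.loc p hfid hp
  have hT : DepthGE _ h (Loc p ((C →ₗ[A] K) →ₗ[A] K)) := hK.serreS_two_dual.depthGE hp h2 le_rfl
  have hδ := hKp.deltaMap_bijective_of_ev (N := Loc p (C ⧸ LinearMap.ker (deltaMap A K C))) ?_
  · rw [LocalizedModule.subsingleton_iff]
    intro x
    obtain ⟨φ, rfl⟩ := Submodule.mkQ_surjective _ x
    obtain ⟨t, ht, n, hn⟩ := exists_smul_eq_deltaMap p hδ.2 (dmap A K (dmap A K q) φ)
    obtain ⟨c, rfl⟩ := hq.surj n
    refine ⟨t, ht, ?_⟩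
    rw [← map_smul]
    refine (Submodule.Quotient.mk_eq_zero _).mpr ⟨c, LinearMap.ext fun ψ ↦ ?_⟩
    obtain ⟨ψ, rfl⟩ := hq' ψ
    exact (LinearMap.congr_fun hn ψ).symm
  · rintro (_ | _ | i)
    · exact ev_localizedModule _ 1 _ hC'
    · exact ((isSES_range hf).localized p.asIdeal.primeCompl).ev_left (hKp.ev_of_mcm hT 1)
        (hKp.ev_of_lt (by omega))
    · exact hKp.ev_of_lt (by omega)

end

lemma ev_one_of_exact (hK : Canonical A d K) (hfid : HasFID A K) [Module.Finite A C]
    [Module.Finite A S]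
    [Module.Finite A T] [Module.Finite A U] {a : S →ₗ[A] C} {u : C →ₗ[A] T} {c : T →ₗ[A] U}
    (ha : Function.Injective a) (hau : Function.Exact a u) (huc : Function.Exact u c)
    (hc : Function.Surjective c) (hS : codGT A d S 1) (hU : codGT A d U 2) (hT : SerreS A 2 T)
    (hT' : HasFID A (T →ₗ[A] K)) (hT3 : SerreS A 3 (T →ₗ[A] K)) [Module.Finite A Z]
    (hZ : DepthGE A d Z) : EV A 1 C Z := by
  have := hK.finite
  have h1 : EV A 1 (Z →ₗ[A] K) (T →ₗ[A] K) := by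
    obtain ⟨b, hb⟩ := hT'
    exact _root_.ev_of_depthGE hK.dim_eq hK.depth_ring
      (fun N _ _ _ m hm ↦ (subsingleton_ext1_iff m).mp (hb N m hm)) d _ (hK.depthGE_dual Z hZ) 1
      (by omega)
  have h2 : EV A 1 T Z := (ev_one_dual_comm (hK.ev_one_of_serreS hfid hT hT3) h1).congr_right
    (LinearEquiv.ofBijective _ (hK.deltaMap_bijective hZ)).symm
  have hs₁ : IsSES a u.rangeRestrict := ⟨ha, fun x ↦ by
    rw [← hau x, ← LinearMap.mem_ker, LinearMap.ker_rangeRestrict, LinearMap.mem_ker],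
    u.surjective_rangeRestrict⟩
  have hs₂ : IsSES (LinearMap.range u).subtype c := ⟨Submodule.injective_subtype _, fun x ↦ by
    rw [huc x]; simp, hc⟩
  exact hs₁.ev_mid (hS.ev le_rfl hZ) (hs₂.ev_left h2 (hU.ev le_rfl hZ))

/-- The cokernel dual of a preenvelope satisfies `(S₃)`. -/
lemma serreS_three_dual_coker (hK : Canonical A d K) [Module.Finite A M] [Module.Finite A X]
    (hX : DepthGE A d X)
    {μ : M →ₗ[A] X} (hμ : Function.Surjective (dmap A K μ)) :
    SerreS A 3 ((X ⧸ LinearMap.range μ) →ₗ[A] K) := by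
  have := hK.finite
  rw [serreS_iff]
  rintro p (_ | h) hp
  · exact depthGE_zero
  have hs : IsSES (dmap A K (LinearMap.range μ).mkQ) (dmap A K μ) :=
    ⟨dmap_injective (Submodule.mkQ_surjective _),
      exact_dmap (LinearMap.exact_map_mkQ_range μ) (Submodule.mkQ_surjective _), hμ⟩
  refine ((hs.localized p.asIdeal.primeCompl).depthGE_left (n := min 2 h) ?_ ?_).mono (by omega)
  · exact (depthGE_loc p hK.dim_eq (hK.depthGE_dual X hX) hp).mono (by omega)
  · exact hK.serreS_two_dual.depthGE hp (by omega) (by omega)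

end Canonical

end Preenvelope

/-- `μ : M → X` with `X` maximal Cohen-Macaulay is a special CM-preenvelope
iff `cod (ker μ) > 0` and there is an exact sequence `0 → S → coker μ → T → U → 0` with
`cod S > 1`, `cod U > 2`, `T` satisfying `(S_2)`, and `T†` of finite injective dimension
satisfying `(S_3)`. -/
theorem special_cm_preenvelope_iff_exact_seq (R : Type) [CommRing R] [IsNoetherianRing R]
    [IsLocalRing R]
    (d : ℕ) (hdim : ringKrullDim R = d) (hCM : (d : ℕ∞) ≤ rdepth R R)
    (ω : Type) [AddCommGroup ω] [Module R ω] (hω : IsCanonicalModule R d ω)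
    (M X : Type) [AddCommGroup M] [Module R M] [AddCommGroup X] [Module R X]
    [Module.Finite R M] (hX : IsMCM R d X) (μ : M →ₗ[R] X) :
    IsSpecialCMPreenvelope R d μ ↔
      codGT R d ↥(LinearMap.ker μ) 0 ∧
        ∃ (S T U : ModuleCat.{0} R) (a : ↥S →ₗ[R] (X ⧸ LinearMap.range μ))
            (u : (X ⧸ LinearMap.range μ) →ₗ[R] ↥T) (c : ↥T →ₗ[R] ↥U),
          Module.Finite R ↥S ∧ Module.Finite R ↥T ∧ Module.Finite R ↥U ∧
          Function.Injective a ∧ Function.Exact a u ∧ Function.Exact u c ∧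
          Function.Surjective c ∧
          codGT R d ↥S 1 ∧ codGT R d ↥U 2 ∧ SerreS R 2 ↥T ∧
          HasFID R (↥T →ₗ[R] ω) ∧ SerreS R 3 (↥T →ₗ[R] ω) := by
  have hK := hω.canonical hdim ((le_rdepth_iff d).mp hCM)
  have hfid := hω.2.1
  have := hK.finite
  have := hX.1
  constructor
  · rintro ⟨⟨-, hpre⟩, hspec⟩
    have hμ : Function.Surjective (dmap R ω μ) := hpre ω hω.1
    have hC : EV R 1 (X ⧸ LinearMap.range μ) ω := (subsingleton_ext1_iff 1).mp (hspec ω hω.1)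
    let e := LinearEquiv.ofBijective
      (deltaMap R ω ((X ⧸ LinearMap.range μ) →ₗ[R] ω))
      (hK.deltaMap_bijective_of_serreS hfid hK.serreS_two_dual)
    refine ⟨hK.codGT_zero_of_le_ker_deltaMap hfid fun m hm ↦ mem_ker_deltaMap.mpr fun φ ↦ ?_,
      ModuleCat.of R (LinearMap.ker (deltaMap R ω (X ⧸ LinearMap.range μ))),
      ModuleCat.of R (((X ⧸ LinearMap.range μ) →ₗ[R] ω) →ₗ[R] ω),
      ModuleCat.of R (_ ⧸ LinearMap.range (deltaMap R ω (X ⧸ LinearMap.range μ))),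
      Submodule.subtype _, deltaMap R ω _, Submodule.mkQ _, inferInstanceAs (Module.Finite R _),
      inferInstanceAs (Module.Finite R _), inferInstanceAs (Module.Finite R _),
      Submodule.injective_subtype _, LinearMap.exact_subtype_ker_map _,
      LinearMap.exact_map_mkQ_range _, Submodule.mkQ_surjective _,
      hK.codGT_one_ker_deltaMap hfid hC, hK.codGT_two_coker_deltaMap hfid hC,
      hK.serreS_two_dual, HasFID.congr (hasFID_of_ev_mcm hK.depth_ring fun Z _ _ _ hZ ↦ ?_) e,
      (hK.serreS_three_dual_coker hX.depthGE hμ).congr e⟩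
    · obtain ⟨ψ, rfl⟩ := hμ φ
      rw [dmap_apply, LinearMap.comp_apply, LinearMap.mem_ker.mp hm, map_zero]
    · exact ev_one_dual_comm (hK.ev_of_mcm hZ 0)
        ((subsingleton_ext1_iff 1).mp (hspec _ (isMCM_of_depthGE (hK.depthGE_dual Z hZ))))
  · rintro ⟨hker, S, T, U, a, u, c, _, _, _, ha, hau, huc, hc, hS, hU, hT, hT', hT3⟩
    have hC (Z : Type) [AddCommGroup Z] [Module R Z] (hZ : IsMCM R d Z) :
        EV R 1 (X ⧸ LinearMap.range μ) Z :=
      have := hZ.1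
      hK.ev_one_of_exact hfid ha hau huc hc hS hU hT hT' hT3 hZ.depthGE
    refine ⟨⟨hX, fun Z _ _ hZ f ↦ ?_⟩, fun Z _ _ hZ ↦ (subsingleton_ext1_iff 1).mpr (hC Z hZ)⟩
    have := hZ.1
    obtain ⟨φ, rfl⟩ := exists_comp_eq (isSES_ker μ.surjective_rangeRestrict).exact
      μ.surjective_rangeRestrict (φ := f) (ev_zero_iff_forall.mp
        ((LinearMap.ker_rangeRestrict μ ▸ hker).ev le_rfl hZ.depthGE) _)
    obtain ⟨ψ, rfl⟩ := (isSES_mkQ (LinearMap.range μ)).exists_extend (hC Z hZ) φ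
    exact ⟨ψ, rfl⟩
end
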